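/- arXiv:1204.6690 — 2 statements merged into one kernel-verified Lean document; each statement's English description precedes it below -/
import Mathlib

section
/- Let α > 0, M > 0, and let f = (f_1, …, f_n) : B^n → C^n be continuously differentiable with all partial derivatives ∂f_j/∂z_k and ∂f_j/∂z̄_k (1 ≤ j, k ≤ n) hyperbolic-harmonic on B^n. Suppose f(0) = 0, det J_f(0) = 1 and ‖f‖_{HB_n(α)} = sup_{z∈B^n} (1−|z|²)^α ( |f_z(z)| + |f_{z̄}(z)| ) ≤ M. Then, with ρ = 3^α / ( (2M)^{2n} (3^α + 4^α) ), the image f(B^n(ρ/2)) contains the ball B^n(R) for some R ≥ ρ / (4 M^{2n−1}); in particular f(B^n(ρ/2)) ⊇ B^n( ρ / (4 M^{2n−1}) ). -/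
open MeasureTheory Metric Complex

noncomputable section

/-- `ℂⁿ` with the Euclidean norm. -/
abbrev Cn (n : ℕ) := EuclideanSpace ℂ (Fin n)

/-- The Wirtinger derivative `∂f/∂z_k = (∂f/∂x_k - i ∂f/∂y_k)/2`. -/
noncomputable def wdz (n : ℕ) (f : Cn n → ℂ) (z : Cn n) (k : Fin n) : ℂ :=
  (1 / 2 : ℂ) *
    (fderiv ℝ f z (EuclideanSpace.single k 1) -
      Complex.I * fderiv ℝ f z (EuclideanSpace.single k Complex.I))

/-- The Wirtinger derivative `∂f/∂z̄_k = (∂f/∂x_k + i ∂f/∂y_k)/2`. -/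
noncomputable def wdzbar (n : ℕ) (f : Cn n → ℂ) (z : Cn n) (k : Fin n) : ℂ :=
  (1 / 2 : ℂ) *
    (fderiv ℝ f z (EuclideanSpace.single k 1) +
      Complex.I * fderiv ℝ f z (EuclideanSpace.single k Complex.I))

/-- Euclidean norm of a vector of complex numbers. -/
noncomputable def euclNorm (n : ℕ) (v : Fin n → ℂ) : ℝ :=
  Real.sqrt (∑ k, Complex.normSq (v k))

/-- The Laplace–Beltrami operator
`Δ_h u = (1-|z|²)² Σ_k (u_{x_k x_k} + u_{y_k y_k})
  + 4(n-1)(1-|z|²) Σ_k (x_k u_{x_k} + y_k u_{y_k})`. -/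
noncomputable def laplaceH (n : ℕ) (u : Cn n → ℝ) (z : Cn n) : ℝ :=
  (1 - ‖z‖ ^ 2) ^ 2 *
      ∑ k, (fderiv ℝ (fun w => fderiv ℝ u w (EuclideanSpace.single k 1)) z
              (EuclideanSpace.single k 1) +
            fderiv ℝ (fun w => fderiv ℝ u w (EuclideanSpace.single k Complex.I)) z
              (EuclideanSpace.single k Complex.I)) +
    4 * ((n : ℝ) - 1) * (1 - ‖z‖ ^ 2) *
      ∑ k, ((z k).re * fderiv ℝ u z (EuclideanSpace.single k 1) +
            (z k).im * fderiv ℝ u z (EuclideanSpace.single k Complex.I))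

/-- A complex-valued function on the unit ball of `ℂⁿ` is hyperbolic-harmonic if it is
twice continuously differentiable there and its real and imaginary parts are annihilated
by the Laplace–Beltrami operator. -/
def IsHHarmonic (n : ℕ) (f : Cn n → ℂ) : Prop :=
  ContDiffOn ℝ 2 f (ball 0 1) ∧
    ∀ z ∈ ball (0 : Cn n) 1,
      laplaceH n (fun w => (f w).re) z = 0 ∧ laplaceH n (fun w => (f w).im) z = 0
/-- The operator norm `|A| = max{|Aθ| : θ ∈ ∂Bⁿ}` of an `n×n` complex matrix, with respect to
the Euclidean norm. -/
noncomputable def matOpNorm (n : ℕ) (A : Matrix (Fin n) (Fin n) ℂ) : ℝ :=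
  sSup ((fun θ : Cn n => euclNorm n (A.mulVec fun k => θ k)) '' sphere (0 : Cn n) 1)
/-- The matrix `f_z = (∂f_j/∂z_k)` of Wirtinger derivatives of the components of `f`. -/
noncomputable def fzMat (n : ℕ) (f : Cn n → Cn n) (z : Cn n) : Matrix (Fin n) (Fin n) ℂ :=
  fun j k => wdz n (fun w => f w j) z k

/-- The matrix `f_{z̄} = (∂f_j/∂z̄_k)` of Wirtinger derivatives of the components of `f`. -/
noncomputable def fzbarMat (n : ℕ) (f : Cn n → Cn n) (z : Cn n) : Matrix (Fin n) (Fin n) ℂ :=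
  fun j k => wdzbar n (fun w => f w j) z k

/-- The real `2n×2n` Jacobian matrix of `f : ℂⁿ → ℂⁿ` viewed as a map of the `2n` real
variables `x_1, y_1, …, x_n, y_n`, with rows indexed by `(Re f_j, Im f_j)`. Index `(j, 0)`
stands for `Re f_j` (resp. direction `x_j`) and `(j, 1)` for `Im f_j` (resp. `y_j`). -/
noncomputable def realJac (n : ℕ) (f : Cn n → Cn n) (z : Cn n) :
    Matrix (Fin n × Fin 2) (Fin n × Fin 2) ℝ :=
  fun p q =>
    if p.2 = 0 then
      fderiv ℝ (fun w => (f w p.1).re) z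
        (EuclideanSpace.single q.1 (if q.2 = 0 then 1 else Complex.I))
    else
      fderiv ℝ (fun w => (f w p.1).im) z
        (EuclideanSpace.single q.1 (if q.2 = 0 then 1 else Complex.I))

/-- `f` belongs to `𝒫ℋ(Bⁿ, ℂⁿ)` with all Wirtinger partial derivatives `h`-harmonic:
`f` is continuously differentiable on `Bⁿ` and each `∂f_j/∂z_k`, `∂f_j/∂z̄_k` is
hyperbolic-harmonic. -/
def IsPHH (n : ℕ) (f : Cn n → Cn n) : Prop :=
  ContDiffOn ℝ 1 f (ball 0 1) ∧
    ∀ j k : Fin n, IsHHarmonic n (fun w => fzMat n f w j k) ∧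
      IsHHarmonic n (fun w => fzbarMat n f w j k)

section LbAbstract


lemma lb_second_test (g g' : ℝ → ℝ) (d : ℝ) (hmax : IsLocalMax g 0)
    (h1 : ∀ᶠ t in nhds (0:ℝ), HasDerivAt g (g' t) t) (h2 : HasDerivAt g' d 0) : d ≤ 0 := by
  by_contra hd
  push Not at hd
  have e1 : deriv g =ᶠ[nhds 0] g' := by
    filter_upwards [h1] with t ht using ht.deriv
  have h0 : deriv g 0 = 0 := hmax.deriv_eq_zero
  have h2' : HasDerivAt (deriv g) d 0 := h2.congr_of_eventuallyEq e1
  have hmin : IsLocalMin g 0 := by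
    apply isLocalMin_of_deriv_deriv_pos
    · rw [h2'.deriv]; exact hd
    · exact h0
    · exact h1.self_of_nhds.continuousAt
  have hc : g =ᶠ[nhds 0] fun _ => g 0 := by
    filter_upwards [hmax, hmin] with t a b using le_antisymm a b
  have hc' : deriv g =ᶠ[nhds 0] fun _ => 0 := by
    have := hc.deriv
    simpa using this
  have : d = 0 := by
    rw [← h2'.deriv, hc'.deriv_eq]; simp
  linarith

variable {E : Type*} [NormedAddCommGroup E] [InnerProductSpace ℝ E]

lemma lb_line (u : E → ℝ) (hu : ContDiffOn ℝ 2 u (ball 0 1)) (x v : E) (hx : x ∈ ball (0:E) 1) :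
    (∀ᶠ t in nhds (0:ℝ), HasDerivAt (fun t : ℝ => u (x + t • v)) (fderiv ℝ u (x + t • v) v) t) ∧
    HasDerivAt (fun t : ℝ => fderiv ℝ u (x + t • v) v) (fderiv ℝ (fderiv ℝ u) x v v) 0 := by
  have hl : ∀ t : ℝ, HasDerivAt (fun t : ℝ => x + t • v) v t := fun t => by
    simpa using ((hasDerivAt_id t).smul_const v).const_add x
  have hev : ∀ᶠ t in nhds (0:ℝ), x + t • v ∈ ball (0:E) 1 := by
    apply (hl 0).continuousAt
    simpa using isOpen_ball.mem_nhds hx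
  constructor
  · filter_upwards [hev] with t ht
    have := ((hu.contDiffAt (isOpen_ball.mem_nhds ht)).differentiableAt (by norm_num)).hasFDerivAt
    exact this.comp_hasDerivAt t (hl t)
  · have h2 : DifferentiableAt ℝ (fderiv ℝ u) x :=
      ((hu.contDiffAt (isOpen_ball.mem_nhds hx)).fderiv_right (m := 1) (by norm_num)).differentiableAt
        (by norm_num)
    have h3 : HasFDerivAt (fderiv ℝ u) (fderiv ℝ (fderiv ℝ u) x) (x + (0:ℝ) • v) := by
      simpa using h2.hasFDerivAt
    have h4 := h3.comp_hasDerivAt (0:ℝ) (hl 0)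
    have h5 := h4.clm_apply (hasDerivAt_const (0:ℝ) v)
    simpa using h5

/-- Trace invariance for a bilinear form. -/
lemma lb_trace {ι κ : Type*} [Fintype ι] [Fintype κ] (b : OrthonormalBasis ι ℝ E)
    (c : OrthonormalBasis κ ℝ E) (Q : E →L[ℝ] E →L[ℝ] ℝ) :
    ∑ i, Q (b i) (b i) = ∑ i, Q (c i) (c i) := by
  classical
  have key : ∀ i, Q (b i) (b i) = ∑ k, ∑ l, (inner ℝ (c k) (b i) * inner ℝ (c l) (b i)) * Q (c k) (c l) := by
    intro i
    conv_lhs => rw [← c.sum_repr' (b i)]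
    simp only [map_sum, sum_apply, map_smul, smul_apply, smul_eq_mul, Finset.mul_sum]
    rw [Finset.sum_comm]
    refine Finset.sum_congr rfl fun k _ => Finset.sum_congr rfl fun l _ => by ring
  simp only [key]
  rw [Finset.sum_comm]
  refine Finset.sum_congr rfl fun k _ => ?_
  rw [Finset.sum_comm]
  have : ∀ l, ∑ i, inner ℝ (c k) (b i) * inner ℝ (c l) (b i) * Q (c k) (c l) = inner ℝ (c k) (c l) * Q (c k) (c l) := by
    intro l
    rw [← Finset.sum_mul, ← b.sum_inner_mul_inner (c k) (c l)]
    simp only [real_inner_comm (c l)]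
  simp only [this, orthonormal_iff_ite.mp c.orthonormal]
  simp

/-- Lower bound of a linear map through its determinant. -/
lemma lb_det [FiniteDimensional ℝ E] (N : ℕ) (hN : Module.finrank ℝ E = N + 1) (T : E →ₗ[ℝ] E) (M : ℝ)
    (hM : ∀ v, ‖T v‖ ≤ M * ‖v‖) (v : E) : |LinearMap.det T| * ‖v‖ ≤ M ^ N * ‖T v‖ := by
  rcases eq_or_ne v 0 with rfl | hv
  · simp
  have hv' : ‖v‖ ≠ 0 := norm_ne_zero_iff.mpr hv
  have : Fact (Module.finrank ℝ E = N + 1) := ⟨hN⟩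
  obtain ⟨b, hb⟩ := Orthonormal.exists_orthonormalBasis_extension_of_card_eq (𝕜 := ℝ) (E := E)
    (ι := Fin (N+1)) (by simpa using hN) (v := fun _ => ‖v‖⁻¹ • v) (s := {0}) (by
      rw [orthonormal_iff_ite]
      rintro ⟨i, rfl⟩ ⟨j, rfl⟩
      simp [norm_smul, hv'])
  have hb0 := hb 0 rfl
  set o := b.toBasis.orientation
  have h1 := o.abs_volumeForm_apply_le (fun i => T (b i))
  rw [o.volumeForm_robust b rfl] at h1
  have h2 := b.toBasis.det_comp T b
  have h3 : b.toBasis.det b = 1 := by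
    rw [← b.coe_toBasis]; exact b.toBasis.det_self
  rw [h3, mul_one] at h2
  have h4 : |LinearMap.det T| ≤ ∏ i, ‖T (b i)‖ := by
    rw [← h2]; exact h1
  rw [Fin.prod_univ_succ] at h4
  have h5 : ∏ i : Fin N, ‖T (b i.succ)‖ ≤ M ^ N := by
    calc _ ≤ ∏ i : Fin N, M := Finset.prod_le_prod (fun _ _ => norm_nonneg _) (fun i _ => by
            simpa using hM (b i.succ))
      _ = _ := by simp
  rw [hb0, map_smul, norm_smul, norm_inv, norm_norm] at h4
  calc |LinearMap.det T| * ‖v‖ ≤ (‖v‖⁻¹ * ‖T v‖ * ∏ i : Fin N, ‖T (b i.succ)‖) * ‖v‖ := by gcongr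
    _ = (∏ i : Fin N, ‖T (b i.succ)‖) * ‖T v‖ := by field_simp
    _ ≤ _ := by gcongr


lemma lb_norm_deriv (d h : E) (hd : d ≠ 0) :
    HasDerivAt (fun t : ℝ => ‖d + t • h‖) (inner ℝ d h / ‖d‖) 0 := by
  have hl : HasDerivAt (fun t : ℝ => d + t • h) h 0 := by
    simpa using ((hasDerivAt_id (0:ℝ)).smul_const h).const_add d
  have h1 := hl.norm_sq
  have h2 := h1.sqrt (by simpa using hd)
  simp only [zero_smul, add_zero, Real.sqrt_sq (norm_nonneg _)] at h2
  convert h2 using 1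
  field_simp

/-- The doubled test function. -/
def lbPhi (β : ℝ) (u : E → ℝ) (p : E × E) : ℝ :=
  u p.1 - u p.2 - (β * ‖p.1 - p.2‖ - β ^ 2 / 8 * ‖p.1 - p.2‖ ^ 2) - 2 * ‖p.1 + p.2‖ ^ 2

lemma lb_phi_line (β : ℝ) (u : E → ℝ) (x y v w : E) (hmax : IsLocalMax (lbPhi β u) (x, y)) :
    IsLocalMax (fun t : ℝ => lbPhi β u (x + t • v, y + t • w)) 0 := by
  have hc : ContinuousAt (fun t : ℝ => ((x + t • v, y + t • w) : E × E)) 0 := by fun_prop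
  have := hc.tendsto
  simp only [zero_smul, add_zero] at this
  have h2 := this.eventually hmax
  unfold IsLocalMax IsMaxFilter
  simpa using h2

lemma lb_first (β : ℝ) (u : E → ℝ) (hu : ContDiffOn ℝ 2 u (ball 0 1)) (x y v w : E)
    (hx : x ∈ ball (0:E) 1) (hy : y ∈ ball (0:E) 1) (hxy : x - y ≠ 0)
    (hmax : IsLocalMax (lbPhi β u) (x, y)) :
    fderiv ℝ u x v - fderiv ℝ u y w
      - (β - β ^ 2 / 4 * ‖x - y‖) * (inner ℝ (x - y) (v - w) / ‖x - y‖)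
      - 4 * inner ℝ (x + y) (v + w) = 0 := by
  have h1 := (lb_line u hu x v hx).1.self_of_nhds
  have h2 := (lb_line u hu y w hy).1.self_of_nhds
  have h3 := lb_norm_deriv (x - y) (v - w) hxy
  have h4 : HasDerivAt (fun t : ℝ => ‖(x + y) + t • (v + w)‖ ^ 2) (2 * inner ℝ (x + y) (v + w)) 0 := by
    have hl : HasDerivAt (fun t : ℝ => (x + y) + t • (v + w)) (v + w) 0 := by
      simpa using ((hasDerivAt_id (0:ℝ)).smul_const (v + w)).const_add (x + y)
    simpa using hl.norm_sq
  have h5 := ((h1.sub h2).sub ((h3.const_mul β).sub ((h3.pow 2).const_mul (β ^ 2 / 8)))).sub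
    (h4.const_mul 2)
  have h6 := (lb_phi_line β u x y v w hmax).hasDerivAt_eq_zero (f' := _) (by
    refine h5.congr_of_eventuallyEq (Filter.Eventually.of_forall fun t => ?_)
    simp only [lbPhi, Pi.sub_apply, Pi.pow_apply]
    rw [show x + t • v - (y + t • w) = x - y + t • (v - w) by module,
      show x + t • v + (y + t • w) = x + y + t • (v + w) by module])
  simp only [zero_smul, add_zero] at h6
  rw [← h6]
  norm_num
  ring

lemma lb_second_par (β : ℝ) (u : E → ℝ) (hu : ContDiffOn ℝ 2 u (ball 0 1)) (x y e : E)
    (hx : x ∈ ball (0:E) 1) (hy : y ∈ ball (0:E) 1) (s : ℝ) (hs : 0 < s) (he : ‖e‖ = 1)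
    (hxy : x - y = s • e) (hmax : IsLocalMax (lbPhi β u) (x, y)) :
    fderiv ℝ (fderiv ℝ u) x e e - fderiv ℝ (fderiv ℝ u) y e e ≤ - β ^ 2 := by
  obtain ⟨a1, a2⟩ := lb_line u hu x e hx
  obtain ⟨b1, b2⟩ := lb_line u hu y (-e) hy
  have hm := lb_phi_line β u x y e (-e) hmax
  have hev : (fun t : ℝ => lbPhi β u (x + t • e, y + t • (-e))) =ᶠ[nhds 0] fun t : ℝ =>
      u (x + t • e) - u (y + t • (-e)) - (β * (s + 2 * t) - β ^ 2 / 8 * (s + 2 * t) ^ 2)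
        - 2 * ‖x + y‖ ^ 2 := by
    have : ∀ᶠ t in nhds (0:ℝ), 0 < s + 2 * t := by
      have hc : ContinuousAt (fun t : ℝ => s + 2 * t) 0 := by fun_prop
      apply hc.eventually (lt_mem_nhds (by simpa using hs))
    filter_upwards [this] with t ht
    simp only [lbPhi]
    rw [show x + t • e - (y + t • (-e)) = (x - y) + (2 * t) • e by module, hxy, ← add_smul,
      norm_smul, he, mul_one, Real.norm_of_nonneg ht.le,
      show x + t • e + (y + t • (-e)) = x + y by module]
  have hm' := hm.congr hev
  have hlin : ∀ t : ℝ, HasDerivAt (fun t : ℝ => s + 2 * t) 2 t := fun t => by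
    simpa using ((hasDerivAt_id t).const_mul 2).const_add s
  have := lb_second_test _ (fun t => fderiv ℝ u (x + t • e) e - fderiv ℝ u (y + t • (-e)) (-e)
      - (β * 2 - β ^ 2 / 8 * (2 * (s + 2 * t) * 2)))
      (fderiv ℝ (fderiv ℝ u) x e e - fderiv ℝ (fderiv ℝ u) y (-e) (-e)
        - (0 - β ^ 2 / 8 * (2 * 2 * 2))) hm' (by
    filter_upwards [a1, b1] with t ht1 ht2
    have := ((ht1.sub ht2).sub (((hlin t).const_mul β).sub
      (((hlin t).pow 2).const_mul (β ^ 2 / 8)))).sub_const (2 * ‖x + y‖ ^ 2)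
    refine HasDerivAt.congr_deriv this ?_
    norm_num) (by
    exact (a2.sub b2).sub ((hasDerivAt_const 0 (β * 2)).sub
      ((((hlin 0).const_mul 2).mul_const 2).const_mul (β ^ 2 / 8))))
  simp only [map_neg, neg_apply, neg_neg] at this
  linarith

lemma lb_second_perp (β : ℝ) (u : E → ℝ) (hu : ContDiffOn ℝ 2 u (ball 0 1)) (x y v : E)
    (hx : x ∈ ball (0:E) 1) (hy : y ∈ ball (0:E) 1) (hv : ‖v‖ = 1)
    (hmax : IsLocalMax (lbPhi β u) (x, y)) :
    fderiv ℝ (fderiv ℝ u) x v v - fderiv ℝ (fderiv ℝ u) y v v ≤ 16 := by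
  obtain ⟨a1, a2⟩ := lb_line u hu x v hx
  obtain ⟨b1, b2⟩ := lb_line u hu y v hy
  have hm := lb_phi_line β u x y v v hmax
  have hev : (fun t : ℝ => lbPhi β u (x + t • v, y + t • v)) = fun t : ℝ =>
      u (x + t • v) - u (y + t • v) - (β * ‖x - y‖ - β ^ 2 / 8 * ‖x - y‖ ^ 2)
        - (2 * ‖x + y‖ ^ 2 + (8 * inner ℝ (x + y) v * t + 8 * t ^ 2)) := by
    ext t
    simp only [lbPhi]
    rw [show x + t • v - (y + t • v) = x - y by module,
      show x + t • v + (y + t • v) = (x + y) + (2 * t) • v by module,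
      norm_add_sq_real, norm_smul, inner_smul_right, hv, mul_one, Real.norm_eq_abs, sq_abs]
    ring
  rw [hev] at hm
  have := lb_second_test _ (fun t => fderiv ℝ u (x + t • v) v - fderiv ℝ u (y + t • v) v
      - (8 * inner ℝ (x + y) v * 1 + 8 * (2 * t)))
      (fderiv ℝ (fderiv ℝ u) x v v - fderiv ℝ (fderiv ℝ u) y v v - (0 + 8 * (2 * 1))) hm (by
    filter_upwards [a1, b1] with t ht1 ht2
    have := ((ht1.sub ht2).sub_const (β * ‖x - y‖ - β ^ 2 / 8 * ‖x - y‖ ^ 2)).sub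
      ((((hasDerivAt_id t).const_mul (8 * inner ℝ (x + y) v)).add
        (((hasDerivAt_id t).pow 2).const_mul 8)).const_add (2 * ‖x + y‖ ^ 2))
    refine HasDerivAt.congr_deriv this ?_
    norm_num) (by
    exact (a2.sub b2).sub ((hasDerivAt_const 0 (8 * inner ℝ (x + y) v * 1)).add
      (((hasDerivAt_id 0).const_mul 2).const_mul 8)))
  linarith

lemma lb_pow (n : ℕ) (hn : 1 ≤ n) :
    (63 * n - 47 : ℝ) < ((3 / 2 : ℝ) * 4 ^ n) ^ 2 := by
  obtain ⟨m, rfl⟩ := Nat.exists_eq_add_of_le hn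
  have h := one_add_mul_le_pow (a := (15:ℝ)) (by norm_num) m
  have : ((3 / 2 : ℝ) * 4 ^ (1 + m)) ^ 2 = 36 * (1 + 15) ^ m := by
    rw [mul_pow, ← pow_mul, mul_comm (1+m) 2, pow_mul, pow_add]; norm_num
    ring
  rw [this]
  push_cast
  have hm : (0:ℝ) ≤ m := by positivity
  linarith

/-- The drift bound. -/
lemma lb_drift (x y : E) (P : ℝ) (hx : ‖x‖ ≤ 1 / 2) (hy : ‖y‖ ≤ 1 / 2) (hP : 0 ≤ P)
    (hs : 0 < ‖x - y‖) (hPs : P * ‖x - y‖ ≤ 1) :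
    (1 - ‖x‖ ^ 2)⁻¹ * (P * (inner ℝ (x - y) x / ‖x - y‖) + 4 * inner ℝ (x + y) x)
      - (1 - ‖y‖ ^ 2)⁻¹ * (P * (inner ℝ (x - y) y / ‖x - y‖) - 4 * inner ℝ (x + y) y) ≤ 31 / 4 := by
  have hx0 := norm_nonneg x
  have hy0 := norm_nonneg y
  have hx2 : 3 / 4 ≤ 1 - ‖x‖ ^ 2 := by nlinarith
  have hy2 : 3 / 4 ≤ 1 - ‖y‖ ^ 2 := by nlinarith
  set s := ‖x - y‖ with hsdef
  set k := (1 - ‖x‖ ^ 2)⁻¹ with hk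
  set l := (1 - ‖y‖ ^ 2)⁻¹ with hl
  have hk0 : 0 < k := by positivity
  have hl0 : 0 < l := by positivity
  have hk1 : k ≤ 4 / 3 := by
    rw [hk, show (4/3 : ℝ) = (3/4)⁻¹ by norm_num]; exact inv_anti₀ (by norm_num) hx2
  have hl1 : l ≤ 4 / 3 := by
    rw [hl, show (4/3 : ℝ) = (3/4)⁻¹ by norm_num]; exact inv_anti₀ (by norm_num) hy2
  have hkl : k - l = k * l * ((‖x‖ - ‖y‖) * (‖x‖ + ‖y‖)) := by
    rw [hk, hl]; field_simp; ring
  have hdiff : |‖x‖ - ‖y‖| ≤ s := abs_norm_sub_norm_le x y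
  have hkl2 : |k - l| ≤ 16 / 9 * s := by
    rw [hkl, abs_mul, abs_mul (‖x‖ - ‖y‖), abs_of_pos (mul_pos hk0 hl0), abs_of_nonneg (add_nonneg hx0 hy0)]
    have : k * l ≤ 4 / 3 * (4 / 3) := mul_le_mul hk1 hl1 hl0.le (by norm_num)
    calc k * l * (|‖x‖ - ‖y‖| * (‖x‖ + ‖y‖)) ≤ (4 / 3 * (4 / 3)) * (s * 1) := by
          gcongr; linarith
      _ = _ := by ring
  have hdy : |inner ℝ (x - y) y| ≤ s * (1 / 2) :=
    (abs_real_inner_le_norm _ _).trans (by gcongr)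
  have hdx : inner ℝ (x - y) x = s ^ 2 + inner ℝ (x - y) y := by
    rw [hsdef, ← real_inner_self_eq_norm_sq, ← inner_add_right, sub_add_cancel]
  have h1 : (k - l) * inner ℝ (x - y) y ≤ 8 / 9 * s ^ 2 := by
    calc _ ≤ |(k - l) * inner ℝ (x - y) y| := le_abs_self _
      _ = |k - l| * |inner ℝ (x - y) y| := abs_mul _ _
      _ ≤ (16 / 9 * s) * (s * (1 / 2)) := by gcongr
      _ = _ := by ring
  have hsum : ‖x + y‖ ≤ 1 := (norm_add_le _ _).trans (by linarith)
  have h2 : inner ℝ (x + y) x ≤ 1 / 2 :=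
    (real_inner_le_norm _ _).trans ((mul_le_mul hsum hx hx0 (by norm_num)).trans (by norm_num))
  have h3 : inner ℝ (x + y) y ≤ 1 / 2 :=
    (real_inner_le_norm _ _).trans ((mul_le_mul hsum hy hy0 (by norm_num)).trans (by norm_num))
  have h2' : k * inner ℝ (x + y) x ≤ 2 / 3 := by nlinarith
  have h3' : l * inner ℝ (x + y) y ≤ 2 / 3 := by nlinarith
  have h4 : k * inner ℝ (x - y) x - l * inner ℝ (x - y) y ≤ 20 / 9 * s ^ 2 := by
    rw [hdx]; nlinarith [sq_nonneg s]
  have h5 : P / s * (k * inner ℝ (x - y) x - l * inner ℝ (x - y) y) ≤ 20 / 9 := by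
    calc _ ≤ P / s * (20 / 9 * s ^ 2) := by gcongr
      _ = 20 / 9 * (P * s) := by field_simp
      _ ≤ _ := by linarith
  calc _ = P / s * (k * inner ℝ (x - y) x - l * inner ℝ (x - y) y)
        + 4 * (k * inner ℝ (x + y) x + l * inner ℝ (x + y) y) := by ring
    _ ≤ _ := by linarith

lemma lb_nomax {ι : Type*} [Fintype ι] (n : ℕ) (hn : 1 ≤ n) (b : OrthonormalBasis ι ℝ E)
    (hcard : Fintype.card ι = 2 * n) (u : E → ℝ) (hu : ContDiffOn ℝ 2 u (ball 0 1))
    (heq : ∀ z ∈ ball (0:E) 1, (1 - ‖z‖ ^ 2) * ∑ i, fderiv ℝ (fderiv ℝ u) z (b i) (b i)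
      + 4 * ((n:ℝ) - 1) * fderiv ℝ u z z = 0) (x y : E) (hx : ‖x‖ < 1 / 2) (hy : ‖y‖ < 1 / 2)
    (hs0 : 0 < ‖x - y‖) (β : ℝ) (hβ : β = 3 / 2 * 4 ^ n) (hs1 : β * ‖x - y‖ < 4)
    (hmax : IsLocalMax (lbPhi β u) (x, y)) : False := by
  classical
  have : FiniteDimensional ℝ E := b.toBasis.finiteDimensional_of_finite
  have hβ0 : 0 < β := by rw [hβ]; positivity
  have hx1 : x ∈ ball (0:E) 1 := by simp; linarith
  have hy1 : y ∈ ball (0:E) 1 := by simp; linarith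
  have hne : x - y ≠ 0 := norm_pos_iff.mp hs0
  set e : E := ‖x - y‖⁻¹ • (x - y) with he
  have he1 : ‖e‖ = 1 := by rw [he, norm_smul, norm_inv, norm_norm]; field_simp
  have hxe : x - y = ‖x - y‖ • e := by rw [he, smul_smul, mul_inv_cancel₀ hs0.ne', one_smul]
  have hcpos : 0 < Fintype.card ι := by omega
  obtain ⟨i0⟩ : Nonempty ι := Fintype.card_pos_iff.mp hcpos
  obtain ⟨c, hc⟩ := Orthonormal.exists_orthonormalBasis_extension_of_card_eq (𝕜 := ℝ) (E := E)
    (ι := ι) (Module.finrank_eq_card_basis b.toBasis) (v := fun _ => e) (s := {i0}) (by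
      rw [orthonormal_iff_ite]
      rintro ⟨i, rfl⟩ ⟨j, rfl⟩
      simp [he1])
  have hc0 := hc i0 rfl
  set Qx := fderiv ℝ (fderiv ℝ u) x with hQx
  set Qy := fderiv ℝ (fderiv ℝ u) y with hQy
  have hS : ∑ i, Qx (b i) (b i) - ∑ i, Qy (b i) (b i) ≤ 16 * (2 * n - 1) - β ^ 2 := by
    rw [lb_trace b c, lb_trace b c, ← Finset.sum_sub_distrib,
      ← Finset.add_sum_erase _ _ (Finset.mem_univ i0), hc0]
    have h1 := lb_second_par β u hu x y e hx1 hy1 _ hs0 he1 hxe hmax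
    have h2 : ∑ i ∈ Finset.univ.erase i0, (Qx (c i) (c i) - Qy (c i) (c i)) ≤ 
        ∑ i ∈ Finset.univ.erase i0, (16:ℝ) := Finset.sum_le_sum fun i _ =>
      lb_second_perp β u hu x y (c i) hx1 hy1 (by simp) hmax
    rw [Finset.sum_const, Finset.card_erase_of_mem (Finset.mem_univ _), Finset.card_univ, hcard,
      nsmul_eq_mul, Nat.cast_sub (by omega)] at h2
    push_cast at h2
    linarith
  have hfx := lb_first β u hu x y x 0 hx1 hy1 hne hmax
  have hfy := lb_first β u hu x y 0 y hx1 hy1 hne hmax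
  simp only [map_zero, sub_zero, zero_sub, add_zero, zero_add, inner_neg_right] at hfx hfy
  have hd := lb_drift x y (β - β ^ 2 / 4 * ‖x - y‖) hx.le hy.le (by nlinarith) hs0
    (by nlinarith [sq_nonneg (β * ‖x - y‖ / 2 - 1)])
  have ex := heq x hx1
  have ey := heq y hy1
  have hx2 : 0 < 1 - ‖x‖ ^ 2 := by nlinarith [norm_nonneg x]
  have hy2 : 0 < 1 - ‖y‖ ^ 2 := by nlinarith [norm_nonneg y]
  have hfx' : fderiv ℝ u x x = (β - β ^ 2 / 4 * ‖x - y‖) * (inner ℝ (x - y) x / ‖x - y‖)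
    + 4 * inner ℝ (x + y) x := by linarith
  have hfy' : fderiv ℝ u y y = (β - β ^ 2 / 4 * ‖x - y‖) * (inner ℝ (x - y) y / ‖x - y‖)
    - 4 * inner ℝ (x + y) y := by rw [neg_div] at hfy; linarith
  rw [← hfx', ← hfy'] at hd
  have sx : ∑ i, Qx (b i) (b i) = - (4 * ((n:ℝ) - 1)) * ((1 - ‖x‖ ^ 2)⁻¹ * fderiv ℝ u x x) := by
    field_simp; linarith
  have sy : ∑ i, Qy (b i) (b i) = - (4 * ((n:ℝ) - 1)) * ((1 - ‖y‖ ^ 2)⁻¹ * fderiv ℝ u y y) := by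
    field_simp; linarith
  rw [sx, sy] at hS
  have hn' : (0:ℝ) ≤ (n:ℝ) - 1 := by
    have : (1:ℝ) ≤ n := by exact_mod_cast hn
    linarith
  have hp := lb_pow n hn
  rw [← hβ] at hp
  have := mul_le_mul_of_nonneg_left hd (mul_nonneg (by norm_num : (0:ℝ) ≤ 4) hn')
  nlinarith

lemma lb_schwarz {ι : Type*} [Fintype ι] (n : ℕ) (hn : 1 ≤ n) (b : OrthonormalBasis ι ℝ E)
    (hcard : Fintype.card ι = 2 * n) (u : E → ℝ) (hu : ContDiffOn ℝ 2 u (ball 0 1))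
    (heq : ∀ z ∈ ball (0:E) 1, (1 - ‖z‖ ^ 2) * ∑ i, fderiv ℝ (fderiv ℝ u) z (b i) (b i)
      + 4 * ((n:ℝ) - 1) * fderiv ℝ u z z = 0)
    (hbd : ∀ z : E, ‖z‖ ≤ 1 / 2 → |u z| ≤ 1) (z : E) (hz : 4 * 4 ^ n * ‖z‖ ≤ 1) :
    u z - u 0 ≤ 2 * 4 ^ n * ‖z‖ := by
  have : FiniteDimensional ℝ E := b.toBasis.finiteDimensional_of_finite
  have h4n : (4:ℝ) ≤ 4 ^ n := by
    calc (4:ℝ) = 4 ^ 1 := by norm_num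
      _ ≤ 4 ^ n := pow_le_pow_right₀ (by norm_num) hn
  obtain ⟨β, hβ⟩ : ∃ β : ℝ, β = 3 / 2 * 4 ^ n := ⟨_, rfl⟩
  have hβ6 : 6 ≤ β := by rw [hβ]; linarith
  have hz0 := norm_nonneg z
  have hz16 : ‖z‖ ≤ 1 / 16 := by nlinarith
  have hβz : β * ‖z‖ ≤ 4 := by rw [hβ]; nlinarith
  set D : Set (E × E) := {p | ‖p.1‖ ≤ 1 / 2 ∧ ‖p.2‖ ≤ 1 / 2 ∧ β * ‖p.1 - p.2‖ ≤ 4} with hD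
  have hDc : IsCompact D := by
    apply IsCompact.of_isClosed_subset
      ((isCompact_closedBall (0:E) (1/2)).prod (isCompact_closedBall (0:E) (1/2)))
    · have k1 : IsClosed {p : E × E | ‖p.1‖ ≤ 1 / 2} := isClosed_le (by fun_prop) (by fun_prop)
      have k2 : IsClosed {p : E × E | ‖p.2‖ ≤ 1 / 2} := isClosed_le (by fun_prop) (by fun_prop)
      have k3 : IsClosed {p : E × E | β * ‖p.1 - p.2‖ ≤ 4} :=
        isClosed_le (by fun_prop) (by fun_prop)
      exact k1.inter (k2.inter k3)
    · rintro ⟨p, q⟩ ⟨h1, h2, -⟩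
      exact ⟨by simpa using h1, by simpa using h2⟩
  have hzD : (z, (0:E)) ∈ D := ⟨by simp; linarith, by simp, by simpa using hβz⟩
  have hcont : ContinuousOn (lbPhi β u) D := by
    have hu' := hu.continuousOn
    have c1 : ContinuousOn (fun p : E × E => u p.1) D :=
      hu'.comp continuousOn_fst (fun p hp => by simp; linarith [hp.1])
    have c2 : ContinuousOn (fun p : E × E => u p.2) D :=
      hu'.comp continuousOn_snd (fun p hp => by simp; linarith [hp.2.1])
    have c3 : ContinuousOn (fun p : E × E => (β * ‖p.1 - p.2‖ - β ^ 2 / 8 * ‖p.1 - p.2‖ ^ 2)) D := by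
      fun_prop
    have c4 : ContinuousOn (fun p : E × E => 2 * ‖p.1 + p.2‖ ^ 2) D := by fun_prop
    exact ((c1.sub c2).sub c3).sub c4
  obtain ⟨⟨x, y⟩, hp, hmax⟩ := hDc.exists_isMaxOn ⟨_, hzD⟩ hcont
  have hle : lbPhi β u (x, y) ≤ 0 := by
    by_contra hpos
    push Not at hpos
    obtain ⟨hx, hy, hs⟩ := hp
    simp only at hx hy hs
    have hux := abs_le.mp (hbd x hx)
    have huy := abs_le.mp (hbd y hy)
    simp only [lbPhi] at hpos
    have hs00 := norm_nonneg (x - y)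
    have hbdry : ∀ a c : E, ‖a‖ = 1 / 2 → β * ‖a - c‖ ≤ 4 →
        2 ≤ (β * ‖a - c‖ - β ^ 2 / 8 * ‖a - c‖ ^ 2) + 2 * ‖a + c‖ ^ 2 := by
      intro a c ha hac
      have h0 := norm_nonneg (a - c)
      have h1 : 1 - ‖a - c‖ ≤ ‖a + c‖ := by
        have : ‖(2:ℝ) • a‖ ≤ ‖a + c‖ + ‖a - c‖ := by
          rw [show (2:ℝ) • a = (a + c) + (a - c) by module]; exact norm_add_le _ _
        rw [norm_smul, ha] at this
        norm_num at this
        linarith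
      have h2 : 0 ≤ 1 - β * ‖a - c‖ / 4 := by linarith
      have h3 : 1 - β * ‖a - c‖ / 4 ≤ ‖a + c‖ := by nlinarith
      have h4 := mul_self_le_mul_self h2 h3
      nlinarith
    have hx' : ‖x‖ < 1 / 2 := by
      refine lt_of_le_of_ne hx fun h => ?_
      have := hbdry x y h hs
      linarith
    have hy' : ‖y‖ < 1 / 2 := by
      refine lt_of_le_of_ne hy fun h => ?_
      have := hbdry y x h (by rwa [norm_sub_rev])
      rw [norm_sub_rev, add_comm y x] at this
      linarith
    have hs' : β * ‖x - y‖ < 4 := by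
      refine lt_of_le_of_ne hs fun h => ?_
      have : β ^ 2 / 8 * ‖x - y‖ ^ 2 = 2 := by
        rw [show β ^ 2 / 8 * ‖x - y‖ ^ 2 = (β * ‖x - y‖) ^ 2 / 8 by ring, h]; norm_num
      nlinarith [sq_nonneg ‖x + y‖]
    have hs0 : 0 < ‖x - y‖ := by
      refine lt_of_le_of_ne hs00 fun h => ?_
      have : x = y := by rw [← sub_eq_zero, ← norm_eq_zero, ← h]
      subst this
      simp at hpos
      nlinarith [sq_nonneg ‖x + x‖]
    refine lb_nomax n hn b hcard u hu heq x y hx' hy' hs0 β hβ hs' ?_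
    have hnh : D ∈ nhds (x, y) := by
      have c1 : ∀ᶠ p : E × E in nhds (x, y), ‖p.1‖ < 1 / 2 :=
        (by fun_prop : ContinuousAt (fun p : E × E => ‖p.1‖) (x, y)).eventually (gt_mem_nhds hx')
      have c2 : ∀ᶠ p : E × E in nhds (x, y), ‖p.2‖ < 1 / 2 :=
        (by fun_prop : ContinuousAt (fun p : E × E => ‖p.2‖) (x, y)).eventually (gt_mem_nhds hy')
      have c3 : ∀ᶠ p : E × E in nhds (x, y), β * ‖p.1 - p.2‖ < 4 :=
        (by fun_prop : ContinuousAt (fun p : E × E => β * ‖p.1 - p.2‖) (x, y)).eventually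
          (gt_mem_nhds hs')
      filter_upwards [c1, c2, c3] with p h1 h2 h3 using ⟨h1.le, h2.le, h3.le⟩
    exact hmax.isLocalMax hnh
  have hfin := (hmax hzD).trans hle
  simp only [lbPhi, sub_zero, add_zero] at hfin
  have : 0 ≤ β ^ 2 / 8 * ‖z‖ ^ 2 := by positivity
  rw [hβ] at hfin this
  nlinarith


lemma lb_cover [FiniteDimensional ℝ E] (f : E → E) (hf : ContDiffOn ℝ 1 f (ball 0 1))
    (hf0 : f 0 = 0) (r c C : ℝ) (hr : 0 < r) (hr1 : r < 1) (hC : 0 ≤ C)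
    (hCr : C * r < c) (hlow : ∀ v, c * ‖v‖ ≤ ‖fderiv ℝ f 0 v‖)
    (hdiff : ∀ z : E, ‖z‖ ≤ r → ∀ v, ‖fderiv ℝ f z v - fderiv ℝ f 0 v‖ ≤ C * ‖z‖ * ‖v‖) :
    ball (0:E) (c * r / 2) ⊆ f '' ball 0 r := by
  have hc : 0 < c := lt_of_le_of_lt (by positivity) hCr
  have hfz : ∀ z : E, ‖z‖ ≤ r → ContDiffAt ℝ 1 f z := fun z hz =>
    hf.contDiffAt (isOpen_ball.mem_nhds (by simp; linarith))
  -- boundary estimate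
  have hbdry : ∀ z : E, ‖z‖ = r → c * r / 2 ≤ ‖f z‖ := by
    intro z hz
    have hz1 : ∀ t ∈ Set.Icc (0:ℝ) 1, ‖t • z‖ ≤ r := by
      intro t ht
      rw [norm_smul, hz, Real.norm_of_nonneg ht.1]
      nlinarith [ht.2]
    have hder : ∀ t ∈ Set.Icc (0:ℝ) 1, HasDerivAt (fun t : ℝ => f (t • z) - fderiv ℝ f 0 (t • z))
        (fderiv ℝ f (t • z) z - fderiv ℝ f 0 z) t := by
      intro t ht
      have hl : HasDerivAt (fun t : ℝ => t • z) z t := by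
        simpa using (hasDerivAt_id t).smul_const z
      have h1 := (((hfz _ (hz1 t ht)).differentiableAt (by norm_num)).hasFDerivAt).comp_hasDerivAt t hl
      exact h1.sub ((fderiv ℝ f 0).hasFDerivAt.comp_hasDerivAt t hl)
    have := image_norm_le_of_norm_deriv_right_le_deriv_boundary
      (f := fun t : ℝ => f (t • z) - fderiv ℝ f 0 (t • z)) (a := 0) (b := 1)
      (f' := fun t => fderiv ℝ f (t • z) z - fderiv ℝ f 0 z)
      (B := fun t => C * r ^ 2 / 2 * t ^ 2) (B' := fun t => C * r ^ 2 / 2 * (2 * t))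
      (fun t ht => (hder t ht).continuousAt.continuousWithinAt)
      (fun t ht => (hder t ⟨ht.1, ht.2.le⟩).hasDerivWithinAt)
      (by simp [hf0])
      (fun t => by simpa using ((hasDerivAt_id t).pow 2).const_mul (C * r ^ 2 / 2))
      (fun t ht => by
        refine (hdiff _ (hz1 t ⟨ht.1, ht.2.le⟩) z).trans (le_of_eq ?_)
        rw [norm_smul, hz, Real.norm_of_nonneg ht.1]; ring)
      (x := 1) (by simp)
    simp only [one_smul] at this
    have h2 := hlow z
    rw [hz] at h2
    have h3 : ‖fderiv ℝ f 0 z‖ ≤ ‖f z‖ + ‖f z - fderiv ℝ f 0 z‖ := by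
      rw [norm_sub_rev]
      exact norm_le_insert' _ _
    nlinarith
  have hopen : IsOpen (f '' ball 0 r) := by
    rw [isOpen_iff_mem_nhds]
    rintro _ ⟨z, hz, rfl⟩
    have hzr : ‖z‖ < r := by simpa using hz
    have hinj : Function.Injective (fderiv ℝ f z : E →ₗ[ℝ] E) := by
      rw [injective_iff_map_eq_zero]
      intro v hv
      by_contra hv0
      have hvpos : 0 < ‖v‖ := norm_pos_iff.mpr hv0
      have h1 := hdiff z hzr.le v
      have h2 := hlow v
      have hv' : fderiv ℝ f z v = 0 := hv
      rw [hv', zero_sub, norm_neg] at h1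
      have : C * ‖z‖ ≤ C * r := by gcongr
      nlinarith
    have hsurj := LinearMap.surjective_of_injective hinj
    have hst : HasStrictFDerivAt f (fderiv ℝ f z) z :=
      (hfz z hzr.le).hasStrictFDerivAt (by norm_num)
    have hmap := hst.map_nhds_eq_of_surj (LinearMap.range_eq_top.mpr hsurj)
    rw [← hmap]
    exact Filter.image_mem_map (isOpen_ball.mem_nhds hz)
  refine (convex_ball (0:E) (c * r / 2)).isPreconnected.subset_of_closure_inter_subset hopen
    ⟨0, by simp; positivity, 0, by simpa using hr, hf0⟩ ?_
  rintro w ⟨hw1, hw2⟩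
  have hcomp : IsCompact (f '' closedBall 0 r) :=
    (isCompact_closedBall (0:E) r).image_of_continuousOn (fun z hz =>
      (hfz z (by simpa using hz)).continuousAt.continuousWithinAt)
  have hsub : closure (f '' ball 0 r) ⊆ f '' closedBall 0 r :=
    closure_minimal (Set.image_mono ball_subset_closedBall) hcomp.isClosed
  obtain ⟨z, hz, rfl⟩ := hsub hw1
  have hz' : ‖z‖ ≤ r := by simpa using hz
  refine ⟨z, ?_, rfl⟩
  have hw3 : ‖f z‖ < c * r / 2 := by simpa using hw2
  rw [mem_ball_zero_iff]
  exact lt_of_le_of_ne hz' fun h => absurd (hbdry z h) (not_le.mpr hw3)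

end LbAbstract

/-- Real orthonormal family of `ℂⁿ`. -/
def lbVec (n : ℕ) (p : Fin n × Fin 2) : Cn n :=
  EuclideanSpace.single p.1 (if p.2 = 0 then 1 else Complex.I)

lemma lb_expand (n : ℕ) (θ : Cn n) :
    θ = ∑ k, ((θ k).re • (EuclideanSpace.single k 1 : Cn n)
      + (θ k).im • (EuclideanSpace.single k Complex.I : Cn n)) := by
  ext j
  simp [Finset.sum_add_distrib, Finset.sum_apply]
  rw [← Finset.sum_add_distrib]
  rw [Finset.sum_eq_single j]
  · simp [Complex.re_add_im]
  · intro b _ hb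
    simp [hb.symm]
  · simp

lemma lb_orthonormal (n : ℕ) : Orthonormal ℝ (lbVec n) := by
  rw [orthonormal_iff_ite]
  rintro ⟨i, a⟩ ⟨j, b⟩
  simp only [lbVec, PiLp.inner_apply, Prod.mk.injEq]
  rw [Finset.sum_eq_single i]
  · by_cases h : i = j
    · subst h
      fin_cases a <;> fin_cases b <;> simp
    · simp [h, Complex.inner]
  · intro k _ hk
    simp [hk, Complex.inner]
  · simp

lemma lb_basis (n : ℕ) : ∃ b : OrthonormalBasis (Fin n × Fin 2) ℝ (Cn n), ∀ p, b p = lbVec n p := by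
  refine ⟨OrthonormalBasis.mk (lb_orthonormal n) ?_, fun p => congrFun (OrthonormalBasis.coe_mk _ _) p⟩
  intro θ _
  rw [lb_expand n θ]
  refine Submodule.sum_mem _ fun k _ => Submodule.add_mem _ ?_ ?_
  · exact Submodule.smul_mem _ _ (Submodule.subset_span ⟨(k, 0), by simp [lbVec]⟩)
  · exact Submodule.smul_mem _ _ (Submodule.subset_span ⟨(k, 1), by simp [lbVec]⟩)

/-- Working version of h-harmonicity for real functions. -/
def lbH (n : ℕ) (u : Cn n → ℝ) : Prop :=
  ContDiffOn ℝ 2 u (ball 0 1) ∧ ∀ z ∈ ball (0 : Cn n) 1,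
    (1 - ‖z‖ ^ 2) * ∑ p, fderiv ℝ (fderiv ℝ u) z (lbVec n p) (lbVec n p)
      + 4 * ((n:ℝ) - 1) * fderiv ℝ u z z = 0

lemma lb_diff {n : ℕ} {u : Cn n → ℝ} (hu : ContDiffOn ℝ 2 u (ball 0 1)) {z : Cn n}
    (hz : z ∈ ball (0 : Cn n) 1) :
    DifferentiableAt ℝ u z ∧ DifferentiableAt ℝ (fderiv ℝ u) z := by
  have h := hu.contDiffAt (isOpen_ball.mem_nhds hz)
  exact ⟨h.differentiableAt (by norm_num),
    (h.fderiv_right (m := 1) (by norm_num)).differentiableAt (by norm_num)⟩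

lemma lb_of_laplaceH (n : ℕ) (u : Cn n → ℝ) (hu : ContDiffOn ℝ 2 u (ball 0 1))
    (h : ∀ z ∈ ball (0 : Cn n) 1, laplaceH n u z = 0) : lbH n u := by
  refine ⟨hu, fun z hz => ?_⟩
  have h0 := h z hz
  obtain ⟨-, hd⟩ := lb_diff hu hz
  have key : ∀ v : Cn n, fderiv ℝ (fun w => fderiv ℝ u w v) z v = fderiv ℝ (fderiv ℝ u) z v v := by
    intro v
    have := hd.hasFDerivAt.clm_apply (hasFDerivAt_const v z)
    rw [this.fderiv]
    simp
  have hz1 : 0 < 1 - ‖z‖ ^ 2 := by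
    have : ‖z‖ < 1 := by simpa using hz
    nlinarith [norm_nonneg z]
  have hzz : fderiv ℝ u z z = ∑ k, ((z k).re * fderiv ℝ u z (EuclideanSpace.single k 1) +
            (z k).im * fderiv ℝ u z (EuclideanSpace.single k Complex.I)) := by
    conv_lhs => rw [lb_expand n z]
    rw [map_sum]
    simp only [map_add, map_smul, smul_eq_mul]
    rw [← lb_expand n z]
  have hsum : ∑ p, fderiv ℝ (fderiv ℝ u) z (lbVec n p) (lbVec n p) =
      ∑ k, (fderiv ℝ (fun w => fderiv ℝ u w (EuclideanSpace.single k 1)) z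
              (EuclideanSpace.single k 1) +
            fderiv ℝ (fun w => fderiv ℝ u w (EuclideanSpace.single k Complex.I)) z
              (EuclideanSpace.single k Complex.I)) := by
    simp only [key]
    rw [Fintype.sum_prod_type]
    simp [lbVec]
  unfold laplaceH at h0
  rw [hzz, hsum]
  have : (1 - ‖z‖ ^ 2) ≠ 0 := hz1.ne'
  apply mul_left_cancel₀ this
  rw [mul_zero, ← h0]
  ring

lemma lbH_add {n : ℕ} {u v : Cn n → ℝ} (hu : lbH n u) (hv : lbH n v) :
    lbH n (fun z => u z + v z) := by
  refine ⟨hu.1.add hv.1, fun z hz => ?_⟩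
  have e : ∀ w ∈ ball (0 : Cn n) 1, fderiv ℝ (fun z => u z + v z) w = fderiv ℝ u w + fderiv ℝ v w :=
    fun w hw => fderiv_fun_add (lb_diff hu.1 hw).1 (lb_diff hv.1 hw).1
  have e2 : fderiv ℝ (fderiv ℝ (fun z => u z + v z)) z
      = fderiv ℝ (fderiv ℝ u) z + fderiv ℝ (fderiv ℝ v) z := by
    have : fderiv ℝ (fun z => u z + v z) =ᶠ[nhds z] fun w => fderiv ℝ u w + fderiv ℝ v w := by
      filter_upwards [isOpen_ball.mem_nhds hz] with w hw using e w hw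
    rw [this.fderiv_eq]
    exact fderiv_fun_add (lb_diff hu.1 hz).2 (lb_diff hv.1 hz).2
  rw [e z hz, e2]
  simp only [add_apply, Finset.sum_add_distrib]
  linear_combination hu.2 z hz + hv.2 z hz

lemma lbH_smul {n : ℕ} {u : Cn n → ℝ} (c : ℝ) (hu : lbH n u) :
    lbH n (fun z => c * u z) := by
  refine ⟨contDiffOn_const.mul hu.1, fun z hz => ?_⟩
  have e : ∀ w ∈ ball (0 : Cn n) 1, fderiv ℝ (fun z => c * u z) w = c • fderiv ℝ u w :=
    fun w hw => fderiv_const_mul (lb_diff hu.1 hw).1 c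
  have e2 : fderiv ℝ (fderiv ℝ (fun z => c * u z)) z = c • fderiv ℝ (fderiv ℝ u) z := by
    have : fderiv ℝ (fun z => c * u z) =ᶠ[nhds z] fun w => c • fderiv ℝ u w := by
      filter_upwards [isOpen_ball.mem_nhds hz] with w hw using e w hw
    rw [this.fderiv_eq]
    exact fderiv_fun_const_smul (lb_diff hu.1 hz).2 c
  rw [e z hz, e2]
  simp only [smul_apply, smul_eq_mul, ← Finset.mul_sum]
  linear_combination c * hu.2 z hz

lemma lbH_sum {n : ℕ} {ι : Type*} (s : Finset ι) (u : ι → Cn n → ℝ) (hu : ∀ i, lbH n (u i)) :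
    lbH n (fun z => ∑ i ∈ s, u i z) := by
  classical
  induction s using Finset.induction_on with
  | empty =>
    refine ⟨by simpa using contDiffOn_const, fun z _ => ?_⟩
    simp
  | insert a s ha ih =>
    simp only [Finset.sum_insert ha]
    exact lbH_add (hu a) ih

lemma lbH_re_mul {n : ℕ} {g : Cn n → ℂ} (hg : IsHHarmonic n g) (a : ℂ) :
    lbH n (fun z => (a * g z).re) := by
  have h1 : lbH n (fun z => (g z).re) := lb_of_laplaceH n _
    (Complex.reCLM.contDiff.comp_contDiffOn hg.1) fun z hz => (hg.2 z hz).1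
  have h2 : lbH n (fun z => (g z).im) := lb_of_laplaceH n _
    (Complex.imCLM.contDiff.comp_contDiffOn hg.1) fun z hz => (hg.2 z hz).2
  have := lbH_add (lbH_smul a.re h1) (lbH_smul (-a.im) h2)
  simpa [Complex.mul_re, sub_eq_add_neg] using this

lemma lb_fderiv_comp {n : ℕ} {f : Cn n → Cn n} {z : Cn n} (hf : DifferentiableAt ℝ f z) (j : Fin n)
    (v : Cn n) : fderiv ℝ (fun w => f w j) z v = fderiv ℝ f z v j := by
  have := ((PiLp.proj 2 (𝕜 := ℝ) (fun _ : Fin n => ℂ) j).hasFDerivAt).comp z hf.hasFDerivAt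
  have h2 : HasFDerivAt (fun w => f w j) _ z := this
  rw [h2.fderiv]
  rfl

lemma lb_wirt {n : ℕ} {f : Cn n → Cn n} {z : Cn n} (hf : DifferentiableAt ℝ f z) (θ : Cn n)
    (j : Fin n) : fderiv ℝ f z θ j = ∑ k, (fzMat n f z j k * θ k
      + fzbarMat n f z j k * (starRingEnd ℂ) (θ k)) := by
  rw [← lb_fderiv_comp hf]
  conv_lhs => rw [lb_expand n θ]
  rw [map_sum]
  refine Finset.sum_congr rfl fun k _ => ?_
  simp only [map_add, map_smul, fzMat, fzbarMat, wdz, wdzbar, Complex.real_smul]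
  set A := fderiv ℝ (fun w => f w j) z (EuclideanSpace.single k 1)
  set B := fderiv ℝ (fun w => f w j) z (EuclideanSpace.single k Complex.I)
  have h1 : θ k + (starRingEnd ℂ) (θ k) = 2 * ((θ k).re : ℂ) := by
    rw [Complex.add_conj]; push_cast; ring
  have h2 : θ k - (starRingEnd ℂ) (θ k) = 2 * ((θ k).im : ℂ) * Complex.I := by
    rw [Complex.sub_conj]; push_cast; ring
  have hI := Complex.I_mul_I
  linear_combination (-(1/2) * A) * h1 + (1/2 * Complex.I * B) * h2 + ((θ k).im * B : ℂ) * hI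

lemma lb_eucl (n : ℕ) (v : Fin n → ℂ) : euclNorm n v = ‖(WithLp.toLp 2 v : Cn n)‖ := by
  rw [EuclideanSpace.norm_eq, euclNorm]
  simp [Complex.normSq_eq_norm_sq]

lemma lb_matop (n : ℕ) (A : Matrix (Fin n) (Fin n) ℂ) (v : Cn n) :
    ‖(WithLp.toLp 2 (A.mulVec fun k => v k) : Cn n)‖ ≤ matOpNorm n A * ‖v‖ := by
  rcases eq_or_ne v 0 with rfl | hv
  · have : (fun k => (0 : Cn n) k) = (0 : Fin n → ℂ) := rfl
    rw [this, Matrix.mulVec_zero]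
    simp
  have hv' : 0 < ‖v‖ := norm_pos_iff.mpr hv
  have hc : Continuous (fun θ : Cn n => euclNorm n (A.mulVec fun k => θ k)) := by
    simp only [lb_eucl, Matrix.mulVec, dotProduct]
    fun_prop
  have hb : BddAbove ((fun θ : Cn n => euclNorm n (A.mulVec fun k => θ k)) '' sphere (0 : Cn n) 1) :=
    ((isCompact_sphere (0 : Cn n) 1).image hc).bddAbove
  have h1 := le_csSup hb ⟨(((‖v‖⁻¹ : ℝ) : ℂ) • v), by simp [norm_smul, hv'.ne'], rfl⟩
  have h2 : A.mulVec (fun k => ((((‖v‖⁻¹ : ℝ) : ℂ) • v) : Cn n) k)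
      = ((‖v‖⁻¹ : ℝ) : ℂ) • A.mulVec (fun k => v k) := by
    rw [← Matrix.mulVec_smul]; rfl
  simp only [h2, lb_eucl, WithLp.toLp_smul, norm_smul] at h1
  have h3 : ‖((‖v‖⁻¹ : ℝ) : ℂ)‖ = ‖v‖⁻¹ := by simp
  rw [h3] at h1
  unfold matOpNorm
  simp only [lb_eucl]
  rw [inv_mul_le_iff₀ hv'] at h1
  linarith

lemma lb_opbound {n : ℕ} {f : Cn n → Cn n} {z : Cn n} (hf : DifferentiableAt ℝ f z) (θ : Cn n) :
    ‖fderiv ℝ f z θ‖ ≤ (matOpNorm n (fzMat n f z) + matOpNorm n (fzbarMat n f z)) * ‖θ‖ := by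
  set θ' : Cn n := WithLp.toLp 2 (fun k => (starRingEnd ℂ) (θ k)) with hθ'
  have hn' : ‖θ'‖ = ‖θ‖ := by
    simp [EuclideanSpace.norm_eq, hθ']
  have e : fderiv ℝ f z θ = WithLp.toLp 2 ((fzMat n f z).mulVec fun k => θ k)
      + WithLp.toLp 2 ((fzbarMat n f z).mulVec fun k => θ' k) := by
    ext j
    rw [lb_wirt hf]
    simp [Matrix.mulVec, dotProduct, Finset.sum_add_distrib, hθ']
  rw [e, add_mul]
  refine (norm_add_le _ _).trans (add_le_add (lb_matop _ _ _) ?_)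
  rw [← hn']
  exact lb_matop _ _ _

lemma lb_jac {n : ℕ} {f : Cn n → Cn n} {z : Cn n} (hf : DifferentiableAt ℝ f z) :
    LinearMap.det (fderiv ℝ f z : Cn n →ₗ[ℝ] Cn n) = (realJac n f z).det := by
  obtain ⟨b, hb⟩ := lb_basis n
  rw [← LinearMap.det_toMatrix b.toBasis]
  congr 1
  ext p q
  rw [LinearMap.toMatrix_apply, OrthonormalBasis.coe_toBasis, OrthonormalBasis.coe_toBasis_repr_apply,
    OrthonormalBasis.repr_apply_apply, hb, hb]
  have hfj : DifferentiableAt ℝ (fun w => f w p.1) z :=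
    ((PiLp.proj 2 (𝕜 := ℝ) (fun _ : Fin n => ℂ) p.1).differentiableAt).comp z hf
  have hre : ∀ v, fderiv ℝ (fun w => (f w p.1).re) z v = (fderiv ℝ f z v p.1).re := by
    intro v
    have h : HasFDerivAt (fun w => (f w p.1).re) _ z :=
      (Complex.reCLM.hasFDerivAt).comp z hfj.hasFDerivAt
    rw [h.fderiv, ← lb_fderiv_comp hf]; rfl
  have him : ∀ v, fderiv ℝ (fun w => (f w p.1).im) z v = (fderiv ℝ f z v p.1).im := by
    intro v
    have h : HasFDerivAt (fun w => (f w p.1).im) _ z :=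
      (Complex.imCLM.hasFDerivAt).comp z hfj.hasFDerivAt
    rw [h.fderiv, ← lb_fderiv_comp hf]; rfl
  simp only [realJac, hre, him]
  obtain ⟨i, a⟩ := p
  rw [PiLp.inner_apply, Finset.sum_eq_single i]
  · fin_cases a <;> simp [lbVec, Complex.inner]
  · intro k _ hk
    simp [lbVec, hk, Complex.inner]
  · simp

/-- The Lipschitz bound for the differential at the origin. -/
lemma lb_lip {n : ℕ} (hn : 1 ≤ n) {f : Cn n → Cn n} (hf : IsPHH n f) (A : ℝ) (hA : 0 < A)
    (hbd : ∀ z : Cn n, ‖z‖ ≤ 1 / 2 → ∀ v, ‖fderiv ℝ f z v‖ ≤ A * ‖v‖)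
    (z : Cn n) (hz : 4 * 4 ^ n * ‖z‖ ≤ 1) (v : Cn n) :
    ‖fderiv ℝ f z v - fderiv ℝ f 0 v‖ ≤ 2 * 4 ^ n * A * ‖z‖ * ‖v‖ := by
  rcases eq_or_ne v 0 with rfl | hv
  · simp
  have hv' : 0 < ‖v‖ := norm_pos_iff.mpr hv
  set w := fderiv ℝ f z v - fderiv ℝ f 0 v with hw
  rcases eq_or_ne w 0 with hw0 | hw0
  · rw [hw0, norm_zero]; positivity
  have hw' : 0 < ‖w‖ := norm_pos_iff.mpr hw0
  have hz12 : ‖z‖ ≤ 1 / 2 := by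
    have h4n : (1:ℝ) ≤ 4 ^ n := one_le_pow₀ (by norm_num)
    nlinarith [norm_nonneg z]
  have hdf : ∀ x : Cn n, ‖x‖ ≤ 1 / 2 → DifferentiableAt ℝ f x := fun x hx =>
    (hf.1.contDiffAt (isOpen_ball.mem_nhds (by simp; linarith))).differentiableAt (by norm_num)
  set c : ℝ := (‖w‖ * A * ‖v‖)⁻¹ with hc
  have hc0 : 0 < c := by positivity
  set u : Cn n → ℝ := fun x => c * ∑ j, ∑ k,
    ((((starRingEnd ℂ) (w j) * v k) * fzMat n f x j k).re
      + (((starRingEnd ℂ) (w j) * (starRingEnd ℂ) (v k)) * fzbarMat n f x j k).re) with hu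
  have huH : lbH n u := lbH_smul c (lbH_sum _ _ fun j => lbH_sum _ _ fun k =>
    lbH_add (lbH_re_mul (hf.2 j k).1 _) (lbH_re_mul (hf.2 j k).2 _))
  have hueq : ∀ x : Cn n, ‖x‖ ≤ 1 / 2 → u x = c * inner ℝ w (fderiv ℝ f x v) := by
    intro x hx
    simp only [hu]
    congr 1
    rw [PiLp.inner_apply]
    refine Finset.sum_congr rfl fun j _ => ?_
    rw [lb_wirt (hdf x hx), Complex.inner, Finset.sum_mul, Complex.re_sum]
    refine Finset.sum_congr rfl fun k _ => ?_
    rw [← Complex.add_re]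
    congr 1
    ring
  obtain ⟨b, hb⟩ := lb_basis n
  have hub : ∀ x : Cn n, ‖x‖ ≤ 1 / 2 → |u x| ≤ 1 := by
    intro x hx
    rw [hueq x hx, abs_mul, abs_of_pos hc0]
    calc c * |inner ℝ w (fderiv ℝ f x v)| ≤ c * (‖w‖ * (A * ‖v‖)) := by
          gcongr
          exact (abs_real_inner_le_norm _ _).trans (by gcongr; exact hbd x hx v)
      _ = 1 := by rw [hc]; field_simp
  have := lb_schwarz n hn b (by simp [mul_comm]) u huH.1 (by simpa only [hb] using huH.2) hub z hz
  rw [hueq z hz12, hueq 0 (by simp), ← mul_sub, ← inner_sub_right, ← hw,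
    real_inner_self_eq_norm_sq, hc] at this
  have h5 : (‖w‖ * A * ‖v‖)⁻¹ * ‖w‖ ^ 2 = ‖w‖ / (A * ‖v‖) := by field_simp
  rw [h5, div_le_iff₀ (by positivity)] at this
  linarith

/-- Let `α, M > 0` and let `f : Bⁿ → ℂⁿ` be continuously differentiable with
all Wirtinger partial derivatives `h`-harmonic, `f(0) = 0`, `det J_f(0) = 1`, and
`sup_{z∈Bⁿ} (1−|z|²)^α (|f_z(z)| + |f_{z̄}(z)|) ≤ M`. Then, with
`ρ = 3^α/((2M)^{2n}(3^α + 4^α))`, the image `f(Bⁿ(ρ/2))` contains the ball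
`Bⁿ(ρ/(4M^{2n−1}))`. -/
theorem landau_bloch_covering (n : ℕ) (hn : 1 ≤ n) (α M : ℝ) (hα : 0 < α) (hM : 0 < M)
    (f : Cn n → Cn n) (hf : IsPHH n f) (hf0 : f 0 = 0)
    (hjac : (realJac n f 0).det = 1)
    (hbd : ∀ z ∈ ball (0 : Cn n) 1,
      (1 - ‖z‖ ^ 2) ^ α * (matOpNorm n (fzMat n f z) + matOpNorm n (fzbarMat n f z)) ≤ M) :
    ball (0 : Cn n)
        ((3 : ℝ) ^ α / ((2 * M) ^ (2 * n) * ((3 : ℝ) ^ α + (4 : ℝ) ^ α)) / (4 * M ^ (2 * n - 1)))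
      ⊆ f ''
        ball 0 ((3 : ℝ) ^ α / ((2 * M) ^ (2 * n) * ((3 : ℝ) ^ α + (4 : ℝ) ^ α)) / 2) := by
  have hf1 : ∀ x : Cn n, ‖x‖ ≤ 1 / 2 → DifferentiableAt ℝ f x := fun x hx =>
    (hf.1.contDiffAt (isOpen_ball.mem_nhds (by simp; linarith))).differentiableAt (by norm_num)
  obtain ⟨m, rfl⟩ : ∃ m, n = m + 1 := ⟨n - 1, by omega⟩
  have hnm : 2 * (m + 1) - 1 = 2 * m + 1 := by omega
  rw [hnm]
  set q : ℝ := (4 / 3 : ℝ) ^ α with hq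
  have hq1 : 1 < q := Real.one_lt_rpow (by norm_num) hα
  have h3 : (0:ℝ) < 3 ^ α := by positivity
  have h43 : (4:ℝ) ^ α = q * 3 ^ α := by
    rw [hq, Real.div_rpow (by norm_num) (by norm_num)]
    field_simp
  -- bound at the origin
  have hb0 : ∀ v, ‖fderiv ℝ f 0 v‖ ≤ M * ‖v‖ := by
    intro v
    refine (lb_opbound (hf1 0 (by simp)) v).trans ?_
    have := hbd 0 (by simp)
    simp at this
    gcongr
  -- bound on the half ball
  have hbA : ∀ z : Cn (m + 1), ‖z‖ ≤ 1 / 2 → ∀ v, ‖fderiv ℝ f z v‖ ≤ (M * q) * ‖v‖ := by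
    intro z hz v
    refine (lb_opbound (hf1 z hz) v).trans ?_
    have h := hbd z (by simp; linarith)
    set S := matOpNorm (m + 1) (fzMat (m + 1) f z) + matOpNorm (m + 1) (fzbarMat (m + 1) f z)
    have hS : S ≤ M * q := by
      have hle : (3 / 4 : ℝ) ^ α ≤ (1 - ‖z‖ ^ 2) ^ α :=
        Real.rpow_le_rpow (by norm_num) (by nlinarith [norm_nonneg z]) hα.le
      have hp : (0:ℝ) < (3 / 4 : ℝ) ^ α := by positivity
      have hqq : (3 / 4 : ℝ) ^ α * q = 1 := by
        rw [hq, ← Real.mul_rpow (by norm_num) (by norm_num)]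
        norm_num
      by_cases hS0 : S ≤ 0
      · exact hS0.trans (by positivity)
      · push Not at hS0
        have h6 : (3 / 4 : ℝ) ^ α * S ≤ M := le_trans (by gcongr) h
        have h7 : q * ((3 / 4 : ℝ) ^ α * S) ≤ q * M := by gcongr
        have h8 : q * ((3 / 4 : ℝ) ^ α * S) = S := by
          rw [← mul_assoc, mul_comm q, hqq, one_mul]
        linarith
    gcongr
  -- lower bound at the origin
  have hfin : Module.finrank ℝ (Cn (m + 1)) = (2 * m + 1) + 1 := by
    obtain ⟨b, -⟩ := lb_basis (m + 1)
    rw [Module.finrank_eq_card_basis b.toBasis]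
    simp
    omega
  have hlow : ∀ v, ‖v‖ ≤ M ^ (2 * m + 1) * ‖fderiv ℝ f 0 v‖ := by
    intro v
    have := lb_det (2 * m + 1) hfin (fderiv ℝ f 0 : Cn (m + 1) →ₗ[ℝ] Cn (m + 1)) M hb0 v
    rw [lb_jac (hf1 0 (by simp)), hjac] at this
    simpa using this
  have hMpow : 1 ≤ M ^ (2 * (m + 1)) := by
    have h1 := hlow (EuclideanSpace.single 0 1)
    have h2 := hb0 (EuclideanSpace.single 0 1)
    have hs : ‖(EuclideanSpace.single 0 1 : Cn (m + 1))‖ = 1 := by simp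
    rw [hs] at h1 h2
    calc (1:ℝ) ≤ M ^ (2 * m + 1) * ‖fderiv ℝ f 0 (EuclideanSpace.single 0 1)‖ := h1
      _ ≤ M ^ (2 * m + 1) * (M * 1) := by gcongr
      _ = M ^ (2 * (m + 1)) := by ring
  have hP : 0 < M ^ (2 * m + 1) := by positivity
  set P := M ^ (2 * m + 1) with hPdef
  have hPM : M ^ (2 * (m + 1)) = P * M := by rw [hPdef]; ring
  have h2M : (2 * M) ^ (2 * (m + 1)) = 4 ^ (m + 1) * (P * M) := by
    rw [mul_pow, hPM, pow_mul]; norm_num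
  have hK1 : (1:ℝ) ≤ 4 ^ (m + 1) := one_le_pow₀ (by norm_num)
  rw [hPM] at hMpow
  have hρ : (3 : ℝ) ^ α / ((2 * M) ^ (2 * (m + 1)) * ((3 : ℝ) ^ α + (4 : ℝ) ^ α))
      = 1 / (4 ^ (m + 1) * (P * M) * (1 + q)) := by
    rw [h2M, h43]
    field_simp
  rw [hρ]
  set K : ℝ := 4 ^ (m + 1) with hK
  set r : ℝ := 1 / (K * (P * M) * (1 + q)) / 2 with hr
  have hK0 : 0 < K := by positivity
  have hr0 : 0 < r := by positivity
  have hr4 : 4 * K * r ≤ 1 := by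
    have : 4 * K * r = 2 / ((P * M) * (1 + q)) := by rw [hr]; field_simp; norm_num
    rw [this, div_le_one (by positivity)]
    nlinarith
  have hrad : 1 / (K * (P * M) * (1 + q)) / (4 * P) = (1 / P) * r / 2 := by
    rw [hr]; field_simp; norm_num
  rw [hrad]
  refine lb_cover f hf.1 hf0 r (1 / P) (2 * K * (M * q)) hr0 ?_ (by positivity) ?_ ?_ ?_
  · nlinarith
  · have : 2 * K * (M * q) * r = (1 / P) * (q / (1 + q)) := by rw [hr]; field_simp
    rw [this]
    have h9 : q / (1 + q) < 1 := by rw [div_lt_one (by positivity)]; linarith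
    have h10 : 0 < 1 / P := by positivity
    nlinarith
  · intro v
    rw [div_mul_eq_mul_div, one_mul, div_le_iff₀ hP, mul_comm]
    exact hlow v
  · intro z hz v
    refine lb_lip hn hf (M * q) (by positivity) hbA z ?_ v
    refine le_trans ?_ hr4
    gcongr
end
end

section
/- Let f : B^n → C^n be a map whose components have hyperbolic-harmonic Wirtinger derivatives, and suppose f(0) = 0, det J_f(0) = 1, and ‖f‖_{HB_n(α)} ≤ M for some α > 0 and M > 0. Set F(ζ) = 2 f(ζ/2) for ζ ∈ B^n. Then for all ζ ∈ B^n, |F_ζ(ζ) − F_ζ(0)| ≤ (2^{2n−1}(3^α + 4^α) M / 3^α) |ζ| and |F_{ζ̄}(ζ) − F_{ζ̄}(0)| ≤ (2^{2n−1}(3^α + 4^α) M / 3^α) |ζ|, where F_ζ and F_{ζ̄} are the n×n Wirtinger-derivative matrices of F and |·| on matrices is the operator norm. -/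
open MeasureTheory Metric Complex

noncomputable section

section
open Topology

noncomputable def J2 {V : Type*} [NormedAddCommGroup V] [NormedSpace ℝ V] (g : ℝ → V) (a b : V) : Prop :=
  ∃ g' : ℝ → V, (∀ᶠ τ in 𝓝 (0:ℝ), HasDerivAt g (g' τ) τ) ∧ g' 0 = a ∧ HasDerivAt g' b 0

theorem J2.congr' {V : Type*} [NormedAddCommGroup V] [NormedSpace ℝ V] {g : ℝ → V} {a b a' b' : V}
    (h : J2 g a b) (ha : a = a') (hb : b = b') : J2 g a' b' := by subst ha hb; exact h

theorem J2.add {g h : ℝ → ℝ} {a b c d : ℝ} (hg : J2 g a b) (hh : J2 h c d) :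
    J2 (fun τ => g τ + h τ) (a + c) (b + d) := by
  obtain ⟨g', h1, h2, h3⟩ := hg
  obtain ⟨k', k1, k2, k3⟩ := hh
  refine ⟨fun τ => g' τ + k' τ, ?_, by simp [h2, k2], h3.add k3⟩
  filter_upwards [h1, k1] with τ p q using p.add q

theorem J2.mul {g h : ℝ → ℝ} {a b c d : ℝ} (hg : J2 g a b) (hh : J2 h c d) :
    J2 (fun τ => g τ * h τ) (a * h 0 + g 0 * c) (b * h 0 + 2 * a * c + g 0 * d) := by
  obtain ⟨g', h1, h2, h3⟩ := hg
  obtain ⟨k', k1, k2, k3⟩ := hh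
  refine ⟨fun τ => g' τ * h τ + g τ * k' τ, ?_, by simp [h2, k2], ?_⟩
  · filter_upwards [h1, k1] with τ p q using p.mul q
  · have := (h3.mul k1.self_of_nhds).add (h1.self_of_nhds.mul k3)
    refine HasDerivAt.congr_deriv this ?_
    rw [h2, k2]; ring

theorem J2.const (c : ℝ) : J2 (fun _ => c) 0 0 :=
  ⟨fun _ => 0, Filter.Eventually.of_forall fun _ => hasDerivAt_const _ _, rfl, hasDerivAt_const _ _⟩

theorem J2.lin (c d : ℝ) : J2 (fun τ => c + τ * d) d 0 :=
  ⟨fun _ => d, Filter.Eventually.of_forall fun τ => by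
    simpa using ((hasDerivAt_id τ).mul_const d).const_add c, rfl, hasDerivAt_const _ _⟩

theorem J2.localMax {g : ℝ → ℝ} {a b : ℝ} (h : J2 g a b) (hm : IsLocalMax g 0) :
    a = 0 ∧ b ≤ 0 := by
  obtain ⟨g', h1, h2, h3⟩ := h
  have ha : a = 0 := by
    rw [← h2]; exact hm.hasDerivAt_eq_zero h1.self_of_nhds
  refine ⟨ha, ?_⟩
  by_contra hb
  push Not at hb
  have hd : deriv g =ᶠ[𝓝 0] g' := by
    filter_upwards [h1] with τ p using p.deriv
  have hdd : deriv (deriv g) 0 = b := by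
    rw [hd.deriv_eq]; exact h3.deriv
  have hmin : IsLocalMin g 0 := isLocalMin_of_deriv_deriv_pos (by rw [hdd]; exact hb)
    (by rw [hd.self_of_nhds, h2, ha]) h1.self_of_nhds.continuousAt
  have hc : g =ᶠ[𝓝 0] fun _ => g 0 := by
    filter_upwards [hm, hmin] with τ p q using le_antisymm p q
  have : deriv (deriv g) 0 = 0 := by
    have h5 : deriv g =ᶠ[𝓝 0] deriv (fun _ => g 0) := hc.deriv
    rw [h5.deriv_eq]; simp
  linarith

variable {E : Type*} [NormedAddCommGroup E] [InnerProductSpace ℝ E]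

theorem J2.comp {u : E → ℝ} {γ : ℝ → E} {a b : E} (h : J2 γ a b) (hu : ContDiffAt ℝ 2 u (γ 0)) :
    J2 (fun τ => u (γ τ)) (fderiv ℝ u (γ 0) a)
      (fderiv ℝ (fderiv ℝ u) (γ 0) a a + fderiv ℝ u (γ 0) b) := by
  obtain ⟨g', h1, h2, h3⟩ := h
  have hc : ContinuousAt γ 0 := h1.self_of_nhds.continuousAt
  have hd : ∀ᶠ y in 𝓝 (γ 0), DifferentiableAt ℝ u y := by
    filter_upwards [hu.eventually (by simp)] with y hy using hy.differentiableAt (by norm_num)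
  refine ⟨fun τ => fderiv ℝ u (γ τ) (g' τ), ?_, by simp [h2], ?_⟩
  · filter_upwards [h1, hc.eventually hd] with τ p q
    exact q.hasFDerivAt.comp_hasDerivAt τ p
  · have h4 : DifferentiableAt ℝ (fderiv ℝ u) (γ 0) :=
      (hu.fderiv_right (m := 1) (by norm_num)).differentiableAt (by norm_num)
    have h5 := h4.hasFDerivAt.comp_hasDerivAt (0:ℝ) h1.self_of_nhds
    have h6 := h5.clm_apply h3
    rw [h2] at h6
    exact h6

theorem max_princ {ι : Type*} [Fintype ι] (b : ι → E) (C : Set E) (hC : IsCompact C) (G : E → ℝ)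
    (hG : ContinuousOn G C) 
    (h : ∀ x ∈ C, G x ≤ 0 ∨ (C ∈ 𝓝 x ∧ ∃ (A1 A2 : E → ℝ) (c d : ℝ), 0 ≤ d ∧
      (∀ e, J2 (fun τ : ℝ => G (x + τ • e)) (A1 e) (A2 e)) ∧
      0 < d * ∑ i, A2 (b i) + c * A1 x)) : ∀ x ∈ C, G x ≤ 0 := by
  intro x hx
  obtain ⟨x0, hx0, hmax⟩ := hC.exists_isMaxOn ⟨x, hx⟩ hG
  refine (hmax hx).trans ?_
  rcases h x0 hx0 with h | ⟨hn, A1, A2, c, d, hd, hJ, hpos⟩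
  · exact h
  · exfalso
    have hl : IsLocalMax G x0 := hmax.isLocalMax hn
    have key : ∀ e, A1 e = 0 ∧ A2 e ≤ 0 := by
      intro e
      apply (hJ e).localMax
      have hcont : Filter.Tendsto (fun τ : ℝ => x0 + τ • e) (𝓝 0) (𝓝 x0) := by
        have : Continuous (fun τ : ℝ => x0 + τ • e) := by fun_prop
        simpa using this.tendsto 0
      have := hcont.eventually hl
      simpa [IsLocalMax, IsMaxFilter] using this
    rw [(key x0).1] at hpos
    have : ∑ i, A2 (b i) ≤ 0 := Finset.sum_nonpos fun i _ => (key _).2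
    nlinarith

theorem J2.inv {g : ℝ → ℝ} {a b : ℝ} (hg : J2 g a b) (h0 : g 0 ≠ 0) :
    J2 (fun τ => (g τ)⁻¹) (-a / (g 0) ^ 2) (-b / (g 0) ^ 2 + 2 * a ^ 2 / (g 0) ^ 3) := by
  obtain ⟨g', h1, h2, h3⟩ := hg
  refine ⟨fun τ => - g' τ / (g τ) ^ 2, ?_, by simp [h2], ?_⟩
  · have : ∀ᶠ τ in 𝓝 (0:ℝ), g τ ≠ 0 := h1.self_of_nhds.continuousAt.eventually_ne h0
    filter_upwards [h1, this] with τ p q using p.inv q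
  · have := h3.neg.div (h1.self_of_nhds.pow 2) (pow_ne_zero 2 h0)
    refine HasDerivAt.congr_deriv this ?_
    simp [h2]
    field_simp
    try ring

theorem J2.smul {g : ℝ → ℝ} {h : ℝ → E} {a b : ℝ} {c d : E} (hg : J2 g a b) (hh : J2 h c d) :
    J2 (fun τ => g τ • h τ) (a • h 0 + g 0 • c) (b • h 0 + (2 * a) • c + g 0 • d) := by
  obtain ⟨g', h1, h2, h3⟩ := hg
  obtain ⟨k', k1, k2, k3⟩ := hh
  refine ⟨fun τ => g' τ • h τ + g τ • k' τ, ?_, by simp [h2, k2], ?_⟩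
  · filter_upwards [h1, k1] with τ p q
    refine HasDerivAt.congr_deriv (p.smul q) ?_
    module
  · have := (h3.smul k1.self_of_nhds).add (h1.self_of_nhds.smul k3)
    refine HasDerivAt.congr_deriv this ?_
    rw [h2, k2]; module

theorem J2.constAdd {h : ℝ → E} {c d : E} (a : E) (hh : J2 h c d) :
    J2 (fun τ => a + h τ) c d := by
  obtain ⟨k', k1, k2, k3⟩ := hh
  refine ⟨k', ?_, k2, k3⟩
  filter_upwards [k1] with τ q using q.const_add a

theorem J2.line (y e : E) : J2 (fun τ : ℝ => y + τ • e) e 0 :=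
  ⟨fun _ => e, Filter.Eventually.of_forall fun τ => by
    simpa using ((hasDerivAt_id τ).smul_const e).const_add y, rfl, hasDerivAt_const _ _⟩

theorem J2.normSq (y e : E) : J2 (fun τ : ℝ => ‖y + τ • e‖ ^ 2) (2 * inner ℝ y e) (2 * ‖e‖ ^ 2) := by
  have h : (fun τ : ℝ => ‖y + τ • e‖ ^ 2) =
      fun τ => (‖y‖ ^ 2 + τ * (2 * inner ℝ y e)) + ((0 + τ * 1) * (0 + τ * 1)) * ‖e‖ ^ 2 := by
    funext τ
    rw [norm_add_sq_real, inner_smul_right, norm_smul, mul_pow, Real.norm_eq_abs, sq_abs]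
    ring
  rw [h]
  refine ((J2.lin _ _).add (((J2.lin 0 1).mul (J2.lin 0 1)).mul (J2.const _))).congr' ?_ ?_ <;> simp

theorem J2.innerLin (y e c : E) : J2 (fun τ : ℝ => inner ℝ (y + τ • e) c) (inner ℝ e c) 0 := by
  have h : (fun τ : ℝ => inner ℝ (y + τ • e) c) = fun τ => inner ℝ y c + τ * inner ℝ e c := by
    funext τ
    rw [inner_add_left, inner_smul_left]; simp
  rw [h]; exact J2.lin _ _

variable {ι : Type*} [Fintype ι]

theorem sum_inner_apply (b : OrthonormalBasis ι ℝ E) (T : E →L[ℝ] ℝ) (y : E) :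
    ∑ i, inner ℝ y (b i) * T (b i) = T y := by
  conv_rhs => rw [← b.sum_repr' y]
  simp [map_sum, real_inner_comm]

theorem sum_inner_sq (b : OrthonormalBasis ι ℝ E) (y : E) :
    ∑ i, inner ℝ y (b i) ^ 2 = ‖y‖ ^ 2 := by
  rw [← b.sum_sq_norm_inner_right y]
  simp [real_inner_comm]

theorem trace_refl (b : OrthonormalBasis ι ℝ E) (B : E →L[ℝ] E →L[ℝ] ℝ)
    (hB : ∀ v w, B v w = B w v) (y : E) (c : ℝ) (hc : c * ‖y‖ ^ 2 = -2) :
    ∑ i, B (b i + (c * inner ℝ y (b i)) • y) (b i + (c * inner ℝ y (b i)) • y)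
      = ∑ i, B (b i) (b i) := by
  have h : ∀ i, B (b i + (c * inner ℝ y (b i)) • y) (b i + (c * inner ℝ y (b i)) • y)
      = B (b i) (b i) + 2 * c * (inner ℝ y (b i) * B y (b i))
        + c ^ 2 * B y y * inner ℝ y (b i) ^ 2 := by
    intro i
    simp only [map_add, map_smul, _root_.add_apply, _root_.smul_apply,
      smul_eq_mul]
    rw [hB (b i) y]; ring
  simp_rw [h]
  rw [Finset.sum_add_distrib, Finset.sum_add_distrib, ← Finset.mul_sum, ← Finset.mul_sum,
    sum_inner_apply, sum_inner_sq]
  linear_combination (c * B y y) * hc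

noncomputable def mob (a x : E) : E := a + ((‖a‖ ^ 2 - 1) * (‖x - a‖ ^ 2)⁻¹) • (x - a)

theorem mob_norm (a x : E) (hx : x ≠ a) :
    1 - ‖mob a x‖ ^ 2 = (‖a‖ ^ 2 - 1) * (‖x - a‖ ^ 2)⁻¹ * (1 - ‖x‖ ^ 2) := by
  have hd' : ‖x - a‖ ≠ 0 := norm_ne_zero_iff.2 (sub_ne_zero.2 hx)
  have hd : ‖x - a‖ ^ 2 ≠ 0 := pow_ne_zero 2 hd'
  have hxe : ‖x‖ ^ 2 = ‖a‖ ^ 2 + 2 * inner ℝ a (x - a) + ‖x - a‖ ^ 2 := by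
    rw [← norm_add_sq_real]; simp
  rw [mob, norm_add_sq_real, inner_smul_right, norm_smul, mul_pow, Real.norm_eq_abs, sq_abs, hxe]
  field_simp
  ring

theorem mob_J2 (a x e : E) (hx : x ≠ a) :
    J2 (fun τ : ℝ => mob a (x + τ • e))
      (((‖a‖ ^ 2 - 1) * (‖x - a‖ ^ 2)⁻¹) •
        (e + ((-2 * (‖x - a‖ ^ 2)⁻¹) * inner ℝ (x - a) e) • (x - a)))
      (((‖a‖ ^ 2 - 1) * (‖x - a‖ ^ 2)⁻¹ ^ 2) •
        ((8 * inner ℝ (x - a) e ^ 2 * (‖x - a‖ ^ 2)⁻¹ - 2 * ‖e‖ ^ 2) • (x - a)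
          + (-4 * inner ℝ (x - a) e) • e)) := by
  have hd : ‖x - a‖ ≠ 0 := (norm_ne_zero_iff.2 (sub_ne_zero.2 hx))
  have h : (fun τ : ℝ => mob a (x + τ • e)) = fun τ => a +
      ((‖a‖ ^ 2 - 1) * (‖(x - a) + τ • e‖ ^ 2)⁻¹) • ((x - a) + τ • e) := by
    funext τ
    rw [mob, show x + τ • e - a = (x - a) + τ • e by abel]
  rw [h]
  refine (J2.constAdd a (((J2.const (‖a‖ ^ 2 - 1)).mul ((J2.normSq (x - a) e).inv ?_)).smul
    (J2.line (x - a) e))).congr' ?_ ?_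
  · simpa using sub_ne_zero.2 hx
  · simp only [zero_smul, add_zero, zero_mul, zero_add]
    match_scalars <;> field_simp
  · simp only [zero_smul, add_zero, zero_mul, zero_add, smul_zero, mul_zero]
    match_scalars <;> field_simp <;> ring

theorem mob_harm (b : OrthonormalBasis ι ℝ E) (u : E → ℝ) (a x : E) (hx : x ≠ a)
    (hu : ContDiffAt ℝ 2 u (mob a x))
    (hL : (1 - ‖mob a x‖ ^ 2) * ∑ i, fderiv ℝ (fderiv ℝ u) (mob a x) (b i) (b i)
      + 2 * ((Fintype.card ι : ℝ) - 2) * fderiv ℝ u (mob a x) (mob a x) = 0) :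
    ∃ A1 A2 : E → ℝ, (∀ e, J2 (fun τ : ℝ => u (mob a (x + τ • e))) (A1 e) (A2 e)) ∧
      (1 - ‖x‖ ^ 2) * ∑ i, A2 (b i) + 2 * ((Fintype.card ι : ℝ) - 2) * A1 x = 0 := by
  have hJ := fun e => (mob_J2 a x e hx).comp (u := u) (by simpa using hu)
  refine ⟨_, _, hJ, ?_⟩
  have hd' : ‖x - a‖ ≠ 0 := norm_ne_zero_iff.2 (sub_ne_zero.2 hx)
  have hd : ‖x - a‖ ^ 2 ≠ 0 := pow_ne_zero 2 hd'
  have hsymm : ∀ v w, fderiv ℝ (fderiv ℝ u) (mob a x) v w = fderiv ℝ (fderiv ℝ u) (mob a x) w v := 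
    fun v w => (hu.isSymmSndFDerivAt (by simp)) v w
  simp only [zero_smul, add_zero]
  rw [Finset.sum_add_distrib]
  simp only [map_smul, _root_.smul_apply, smul_eq_mul, ← Finset.mul_sum]
  rw [trace_refl b _ hsymm (x - a) (-2 * (‖x - a‖ ^ 2)⁻¹) (by field_simp)]
  simp only [map_add, map_smul, smul_eq_mul]
  have h2 : ∑ i, ((8 * inner ℝ (x - a) (b i) ^ 2 * (‖x - a‖ ^ 2)⁻¹ - 2 * ‖b i‖ ^ 2) *
      fderiv ℝ u (mob a x) (x - a) + -4 * inner ℝ (x - a) (b i) * fderiv ℝ u (mob a x) (b i))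
      = (4 - 2 * (Fintype.card ι : ℝ)) * fderiv ℝ u (mob a x) (x - a) := by
    have h3 := sum_inner_sq b (x - a)
    have h4 := sum_inner_apply b (fderiv ℝ u (mob a x)) (x - a)
    have h5 : ∀ i, ((8 * inner ℝ (x - a) (b i) ^ 2 * (‖x - a‖ ^ 2)⁻¹ - 2 * ‖b i‖ ^ 2) *
      fderiv ℝ u (mob a x) (x - a) + -4 * inner ℝ (x - a) (b i) * fderiv ℝ u (mob a x) (b i)) =
      (8 * (‖x - a‖ ^ 2)⁻¹ * fderiv ℝ u (mob a x) (x - a)) * inner ℝ (x - a) (b i) ^ 2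
      + -2 * fderiv ℝ u (mob a x) (x - a) 
      + -4 * (inner ℝ (x - a) (b i) * fderiv ℝ u (mob a x) (b i)) := by
      intro i
      rw [b.norm_eq_one]; ring
    simp_rw [h5]
    rw [Finset.sum_add_distrib, Finset.sum_add_distrib, ← Finset.mul_sum, h3, ← Finset.mul_sum, ← Finset.mul_sum, h4]
    simp only [Finset.sum_const, Finset.card_univ, nsmul_eq_mul]
    field_simp
    ring
  rw [h2]
  have hnorm := mob_norm a x hx
  set T := fderiv ℝ u (mob a x) with hT
  set Λ := ∑ i, fderiv ℝ (fderiv ℝ u) (mob a x) (b i) (b i) with hΛ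
  have hX : T (mob a x) = T a + ((‖a‖ ^ 2 - 1) * (‖x - a‖ ^ 2)⁻¹) * T (x - a) := by
    rw [mob, map_add, map_smul, smul_eq_mul]
  have hTx : T x = T a + T (x - a) := by rw [← map_add]; simp
  have hxe : ‖x‖ ^ 2 = ‖a‖ ^ 2 + 2 * inner ℝ a (x - a) + ‖x - a‖ ^ 2 := by
    rw [← norm_add_sq_real]; simp
  have hin : inner ℝ (x - a) x = inner ℝ a (x - a) + ‖x - a‖ ^ 2 := by
    rw [← real_inner_self_eq_norm_sq, real_inner_comm, ← inner_add_left]; simp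
  rw [hX] at hL
  rw [hnorm] at hL
  rw [hin, hTx]
  rw [hxe] at hL ⊢
  generalize ‖x - a‖ ^ 2 = d2 at *
  generalize ‖a‖ ^ 2 = a2 at *
  generalize inner ℝ a (x - a) = p at *
  have hL' := congrArg (fun z => (a2 - 1) * d2⁻¹ * z) hL
  simp only [mul_zero] at hL'
  rw [← hL']
  field_simp
  ring

theorem ineq2 (n A t m s : ℝ) (hn : 2 ≤ n) (hA : 2 * n ^ 2 ≤ A) (ht : 0 < t) (ht' : t ≤ 1 / 16)
    (hm : n ^ 2 * m ≤ 1) (hs0 : 0 ≤ s) (hs : n * s ≤ 2) :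
    (1 - m) * (n ^ 2 * (2 * (2 * n)) + (A - A * n * s) * (-2 * t * (2 * n))
      - A * n * (4 - 4 * t * (s + t * (1 + m)) + 4 * t ^ 2 * m))
      + 4 * (n - 1) * (n ^ 2 * (2 * m) + (A - A * n * s) * (s + t * (1 + m) - 2 * t * m)) < 0 := by
  have hApos : 0 < A := by nlinarith
  have e : (1 - m) * (n ^ 2 * (2 * (2 * n)) + (A - A * n * s) * (-2 * t * (2 * n))
      - A * n * (4 - 4 * t * (s + t * (1 + m)) + 4 * t ^ 2 * m))
      + 4 * (n - 1) * (n ^ 2 * (2 * m) + (A - A * n * s) * (s + t * (1 + m) - 2 * t * m))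
      = (1 - m) * (4 * n ^ 3 - 4 * t * A * (1 - n * s) - 4 * A * n * (1 - t * s - t ^ 2))
        + (n - 1) * (8 * (n ^ 2 * m) + A * (4 * s * (1 - n * s))) := by ring
  rw [e]
  have h1 : 4 * s * (1 - n * s) ≤ 1 / n := by
    rw [le_div_iff₀ (by linarith)]
    nlinarith [sq_nonneg (2 * (n * s) - 1)]
  have hm1 : n * m ≤ 1 / n := by
    rw [le_div_iff₀ (by linarith)]; nlinarith
  have hninv : 1 / n ≤ 1 := by rw [div_le_one (by linarith)]; linarith
  have h3 : n - 1 ≤ (1 - m) * n := by linarith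
  have hm2 : m < 1 := by nlinarith
  have h4 : (n - 1) * (8 * (n ^ 2 * m) + A * (4 * s * (1 - n * s))) ≤ (n - 1) * (8 + A * (1 / n)) := by
    have := mul_le_mul_of_nonneg_left h1 hApos.le
    apply mul_le_mul_of_nonneg_left _ (by linarith)
    linarith
  have h5 : (n - 1) * (8 + A * (1 / n)) ≤ (1 - m) * n * (8 + A * (1 / n)) := by
    apply mul_le_mul_of_nonneg_right h3
    positivity
  have h6 : (1 - m) * n * (8 + A * (1 / n)) = (1 - m) * (8 * n + A) := by
    field_simp
  have hs1 : s ≤ 1 := by nlinarith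
  have hts : t * s + t ^ 2 ≤ 17 / 256 := by nlinarith
  have h7 : 4 * n ^ 3 - 4 * t * A * (1 - n * s) - 4 * A * n * (1 - t * s - t ^ 2) + (8 * n + A) < 0 := by
    have a1 : - 4 * t * A * (1 - n * s) ≤ 1 / 4 * A := by
      have : -(1 - n * s) ≤ 1 := by linarith
      have h : t * (-(1 - n * s)) ≤ 1 / 16 := by nlinarith
      nlinarith
    have a2 : 4 * A * n * (239 / 256) ≤ 4 * A * n * (1 - t * s - t ^ 2) := by
      apply mul_le_mul_of_nonneg_left _ (by positivity)
      linarith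
    have a3 : 2 * n ^ 2 * (239 / 64 * n - 5 / 4) ≤ A * (239 / 64 * n - 5 / 4) := by
      apply mul_le_mul_of_nonneg_right hA; linarith
    nlinarith [mul_nonneg (by linarith : (0:ℝ) ≤ n) (by linarith : (0:ℝ) ≤ n - 2), mul_nonneg (mul_nonneg (by linarith : (0:ℝ) ≤ n) (by linarith : (0:ℝ) ≤ n)) (by linarith : (0:ℝ) ≤ n - 2)]
  have h8 := mul_neg_of_pos_of_neg (by linarith : 0 < 1 - m) h7
  nlinarith

theorem sum_inner_sq' (b : OrthonormalBasis ι ℝ E) (y : E) :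
    ∑ i, inner ℝ (b i) y ^ 2 = ‖y‖ ^ 2 := by
  rw [← sum_inner_sq b y]
  simp [real_inner_comm]

theorem four_pow_ge (n : ℕ) (hn : 1 ≤ n) : 4 * (n:ℝ) ^ 2 ≤ 4 ^ n := by
  induction n, hn using Nat.le_induction with
  | base => norm_num
  | succ k hk ih =>
    have : (1:ℝ) ≤ k := by exact_mod_cast hk
    rw [pow_succ (4:ℝ) k]; push_cast; nlinarith

set_option maxHeartbeats 1000000 in
theorem schwarz_ge2 [FiniteDimensional ℝ E] (b : OrthonormalBasis ι ℝ E) (n : ℕ) (hn : 2 ≤ n)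
    (hcard : Fintype.card ι = 2 * n) (u : E → ℝ) (hu : ∀ x ∈ ball (0:E) 1, ContDiffAt ℝ 2 u x)
    (hL : ∀ x ∈ ball (0:E) 1, (1 - ‖x‖ ^ 2) * ∑ i, fderiv ℝ (fderiv ℝ u) x (b i) (b i)
      + 2 * ((Fintype.card ι : ℝ) - 2) * fderiv ℝ u x x = 0)
    (K : ℝ) (hK : 0 < K) (hb : ∀ x, ‖x‖ ≤ 1 / 2 → |u x| ≤ K) (e : E) (he : ‖e‖ = 1)
    (t : ℝ) (ht : 0 < t) (ht' : t * 4 ^ n ≤ 1) : u (t • e) - u 0 ≤ 4 ^ n * K * t := by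
  have hnR : (2:ℝ) ≤ n := by exact_mod_cast hn
  have h4n := four_pow_ge n (by omega)
  set A : ℝ := 4 ^ n / 2 with hA
  have hA2 : 2 * (n:ℝ) ^ 2 ≤ A := by rw [hA]; linarith
  have hApos : 0 < A := by nlinarith
  have h16 : (16:ℝ) ≤ 4 ^ n := by nlinarith
  have ht16 : t ≤ 1 / 16 := by nlinarith
  have hrho : 1 / (n:ℝ) ≤ 1 / 2 := by
    apply one_div_le_one_div_of_le <;> linarith
  have hrpos : 0 < 1 / (n:ℝ) := by positivity
  set a : E := t⁻¹ • e with ha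
  have hna : ‖a‖ ^ 2 = 1 / t ^ 2 := by
    rw [ha, norm_smul, he, Real.norm_eq_abs, mul_one, sq_abs]; simp
  have hna1 : 1 < ‖a‖ := by
    rw [ha, norm_smul, he, Real.norm_eq_abs, mul_one, abs_of_pos (by positivity)]
    rw [one_lt_inv₀ ht]; linarith
  set s : E → ℝ := fun x => 2 * inner ℝ x e + (-t) * (1 + ‖x‖ ^ 2) with hs
  set p : E → ℝ := fun x => (n:ℝ) ^ 2 * ‖x‖ ^ 2 + (A * s x + (-(A * n / 2)) * (s x * s x)) with hp
  have hsc : Continuous s := by simp only [hs]; fun_prop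
  have hpc : Continuous p := by simp only [hp]; fun_prop
  set C : Set E := closedBall 0 (1 / n) ∩ {x | 0 ≤ s x} with hC
  have hCc : IsCompact C := (isCompact_closedBall _ _).inter_right (isClosed_le continuous_const hsc)
  have hd : ∀ x, ‖x - a‖ ^ 2 = (‖a‖ ^ 2 - 1) - s x / t := by
    intro x
    rw [norm_sub_sq_real, hna, ha, inner_smul_right]
    simp only [hs]
    field_simp
    ring
  have hxa : ∀ x ∈ C, x ≠ a := by
    rintro x ⟨hx, -⟩ rfl
    rw [mem_closedBall_zero_iff] at hx
    linarith
  have hkap : 0 < ‖a‖ ^ 2 - 1 := by nlinarith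
  have hmobn : ∀ x ∈ C, ‖mob a x‖ ≤ ‖x‖ := by
    intro x hx
    have h1 := mob_norm a x (hxa x hx)
    have h2 : 0 < ‖x - a‖ ^ 2 := pow_pos (norm_pos_iff.2 (sub_ne_zero.2 (hxa x hx))) 2
    have h3 : 1 ≤ (‖a‖ ^ 2 - 1) * (‖x - a‖ ^ 2)⁻¹ := by
      rw [← div_eq_mul_inv, le_div_iff₀ h2, hd, one_mul]
      have : 0 ≤ s x / t := div_nonneg hx.2 ht.le
      linarith
    have h4 : ‖x‖ ≤ 1 / n := mem_closedBall_zero_iff.1 hx.1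
    have h5 : 0 ≤ 1 - ‖x‖ ^ 2 := by nlinarith [norm_nonneg x]
    have h6 : ‖mob a x‖ ^ 2 ≤ ‖x‖ ^ 2 := by nlinarith
    exact (sq_le_sq₀ (norm_nonneg _) (norm_nonneg _)).1 h6
  have hsle : ∀ x, ‖x‖ ≤ 1 / n → n * s x ≤ 2 := by
    intro x hx
    have h1 : inner ℝ x e ≤ ‖x‖ := by
      have := real_inner_le_norm x e
      rwa [he, mul_one] at this
    have h2 : s x ≤ 2 * (1 / n) := by
      simp only [hs]; nlinarith [sq_nonneg ‖x‖]
    have := mul_le_mul_of_nonneg_left h2 (by positivity : (0:ℝ) ≤ n)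
    have h3 : (n:ℝ) * (2 * (1 / n)) = 2 := by field_simp
    linarith
  have hnball : ∀ x ∈ C, x ∈ ball (0:E) 1 ∧ mob a x ∈ ball (0:E) 1 ∧ ‖x‖ ≤ 1 / n := by
    intro x hx
    have h4 : ‖x‖ ≤ 1 / n := mem_closedBall_zero_iff.1 hx.1
    have h5 := hmobn x hx
    exact ⟨mem_ball_zero_iff.2 (by linarith), mem_ball_zero_iff.2 (by linarith), h4⟩
  set G : E → ℝ := fun x => u x + ((-1) * u (mob a x) + (-(2 * K)) * p x) with hG
  have hmobc : ContinuousOn (mob a) C := by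
    intro x hx
    have h2 : ‖x - a‖ ^ 2 ≠ 0 := (pow_pos (norm_pos_iff.2 (sub_ne_zero.2 (hxa x hx))) 2).ne'
    apply ContinuousAt.continuousWithinAt
    unfold mob
    have : ContinuousAt (fun x => (‖x - a‖ ^ 2)⁻¹) x := ContinuousAt.inv₀ (by fun_prop) h2
    fun_prop
  have hGc : ContinuousOn G C := by
    have h1 : ContinuousOn u (ball 0 1) := fun x hx => (hu x hx).continuousAt.continuousWithinAt
    have h2 : ContinuousOn u C := h1.mono fun x hx => (hnball x hx).1
    have h3 : ContinuousOn (fun x => u (mob a x)) C := h1.comp hmobc fun x hx => (hnball x hx).2.1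
    simp only [hG]
    exact h2.add ((continuousOn_const.mul h3).add (continuousOn_const.mul hpc.continuousOn))
  have key := max_princ b C hCc G hGc ?_ (t • e) ?_
  · -- conclusion
    have hte : ‖t • e‖ = t := by rw [norm_smul, he, Real.norm_eq_abs, mul_one, abs_of_pos ht]
    have hmw : mob a (t • e) = 0 := by
      have h1 : t • e - a = (t - t⁻¹) • e := by rw [ha, sub_smul]
      have hne : t - t⁻¹ < 0 := by
        have : 1 < t⁻¹ := by rw [one_lt_inv₀ ht]; linarith
        linarith
      rw [mob, h1, hna, norm_smul, he, Real.norm_eq_abs, mul_one, sq_abs, smul_smul, ha, ← add_smul]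
      have : t⁻¹ + (1 / t ^ 2 - 1) * ((t - t⁻¹) ^ 2)⁻¹ * (t - t⁻¹) = 0 := by
        have h9 : (1 / t ^ 2 - 1) = - t⁻¹ * (t - t⁻¹) := by field_simp; ring
        rw [h9]
        have hne' := hne.ne
        generalize t - t⁻¹ = z at *
        field_simp
        ring
      rw [this, zero_smul]
    have hsw : s (t • e) = t * (1 - t ^ 2) := by
      simp only [hs]
      rw [hte, inner_smul_left, real_inner_self_eq_norm_sq, he]
      simp; ring
    have hpw : p (t • e) ≤ A * t := by
      simp only [hp]
      rw [hsw, hte]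
      have h1 : 1 / 2 ≤ (1 - t ^ 2) ^ 2 := by nlinarith
      have h2 : A * (1 / 2) * t ^ 2 ≤ A * n / 2 * (1 - t ^ 2) ^ 2 * t ^ 2 := by
        apply mul_le_mul_of_nonneg_right _ (by positivity)
        apply mul_le_mul _ h1 (by norm_num) (by positivity)
        nlinarith
      have h3 : (n:ℝ) ^ 2 * t ^ 2 ≤ A / 2 * t ^ 2 := by
        apply mul_le_mul_of_nonneg_right _ (by positivity); linarith
      have h4 : 0 ≤ A * t ^ 3 := by positivity
      nlinarith
    simp only [hG, hmw] at key
    have : 2 * K * p (t • e) ≤ 2 * K * (A * t) := mul_le_mul_of_nonneg_left hpw (by positivity)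
    rw [hA] at this
    linarith
  · intro x hx
    obtain ⟨hx1, hx2, hx3⟩ := hnball x hx
    have hx0 : 0 ≤ s x := hx.2
    have hns := hsle x hx3
    by_cases hsz : s x = 0
    · left
      have h1 : mob a x = x := by
        have h2 : 0 < ‖x - a‖ ^ 2 := pow_pos (norm_pos_iff.2 (sub_ne_zero.2 (hxa x hx))) 2
        have h3 : ‖a‖ ^ 2 - 1 = ‖x - a‖ ^ 2 := by rw [hd, hsz]; simp
        rw [mob, h3, mul_inv_cancel₀ h2.ne']; simp
      simp only [hG, h1, hp, hsz]
      have : 0 ≤ K * ((n:ℝ) ^ 2 * ‖x‖ ^ 2) := by positivity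
      linarith
    by_cases hbd : ‖x‖ = 1 / n
    · left
      have h1 := abs_le.1 (hb x (by linarith))
      have h2 := abs_le.1 (hb (mob a x) (by linarith [hmobn x hx]))
      have h3 : 1 ≤ p x := by
        simp only [hp]
        rw [hbd]
        have : (n:ℝ) ^ 2 * (1 / n) ^ 2 = 1 := by field_simp
        rw [this]
        have : 0 ≤ A * s x * (2 - n * s x) := mul_nonneg (by positivity) (by linarith)
        linarith
      have : 2 * K * 1 ≤ 2 * K * p x := mul_le_mul_of_nonneg_left h3 (by positivity)
      simp only [hG]
      linarith
    right
    have hxlt : ‖x‖ < 1 / n := lt_of_le_of_ne hx3 hbd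
    have hslt : 0 < s x := lt_of_le_of_ne hx0 (Ne.symm hsz)
    refine ⟨Filter.inter_mem (closedBall_mem_nhds_of_mem (mem_ball_zero_iff.2 hxlt))
      (Filter.mem_of_superset ((isOpen_lt continuous_const hsc).mem_nhds hslt)
        fun y (hy : 0 < s y) => show 0 ≤ s y from le_of_lt hy), ?_⟩
    obtain ⟨B1, B2, hJB, hBL⟩ := mob_harm b u a x (hxa x hx) (hu _ hx2) (hL _ hx2)
    have hJu := fun v => (J2.line x v).comp (u := u) (by simpa using hu x hx1)
    have hJs : ∀ v, J2 (fun τ : ℝ => s (x + τ • v)) (inner ℝ v ((2:ℝ) • e - (2 * t) • x)) (-2 * t * ‖v‖ ^ 2) := by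
      intro v
      refine (((J2.const 2).mul (J2.innerLin x v e)).add ((J2.const (-t)).mul ((J2.const 1).add (J2.normSq x v)))).congr' ?_ ?_
      · simp [inner_sub_right, inner_smul_right, real_inner_comm]; ring
      · simp; ring
    have hJp : ∀ v, J2 (fun τ : ℝ => p (x + τ • v))
        ((n:ℝ) ^ 2 * (2 * inner ℝ x v) + (A - A * n * s x) * inner ℝ v ((2:ℝ) • e - (2 * t) • x))
        ((n:ℝ) ^ 2 * (2 * ‖v‖ ^ 2) + (A - A * n * s x) * (-2 * t * ‖v‖ ^ 2) 
          - A * n * inner ℝ v ((2:ℝ) • e - (2 * t) • x) ^ 2) := by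
      intro v
      refine (((J2.const _).mul (J2.normSq x v)).add (((J2.const A).mul (hJs v)).add
        ((J2.const (-(A * n / 2))).mul ((hJs v).mul (hJs v))))).congr' ?_ ?_
      · simp only [zero_smul, add_zero]; ring
      · simp only [zero_smul, add_zero]; ring
    have hJG := fun v => (hJu v).add (((J2.const (-1)).mul (hJB v)).add
      ((J2.const (-(2 * K))).mul (hJp v)))
    refine ⟨_, _, 4 * ((n:ℝ) - 1), 1 - ‖x‖ ^ 2, by nlinarith [norm_nonneg x], hJG, ?_⟩
    have hLx := hL x hx1
    have hcR : (Fintype.card ι : ℝ) = 2 * n := by rw [hcard]; push_cast; ring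
    simp only [zero_smul, add_zero, zero_mul, mul_zero, zero_add, map_zero]
    rw [hcR] at hLx hBL
    have hg : ‖(2:ℝ) • e - (2 * t) • x‖ ^ 2 = 4 - 4 * t * (s x + t * (1 + ‖x‖ ^ 2)) + 4 * t ^ 2 * ‖x‖ ^ 2 := by
      rw [norm_sub_sq_real, norm_smul, norm_smul, inner_smul_left, inner_smul_right, he, mul_pow, mul_pow,
        Real.norm_eq_abs, Real.norm_eq_abs, sq_abs, sq_abs, real_inner_comm]
      simp only [hs]
      simp
      ring
    have hdir : inner ℝ x ((2:ℝ) • e - (2 * t) • x) = s x + t * (1 + ‖x‖ ^ 2) - 2 * t * ‖x‖ ^ 2 := by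
      rw [inner_sub_right, inner_smul_right, inner_smul_right, real_inner_self_eq_norm_sq]
      simp only [hs]; ring
    have hsum : ∑ i, ((n:ℝ) ^ 2 * (2 * ‖b i‖ ^ 2) + (A - A * n * s x) * (-2 * t * ‖b i‖ ^ 2) 
          - A * n * inner ℝ (b i) ((2:ℝ) • e - (2 * t) • x) ^ 2) =
        (n:ℝ) ^ 2 * (2 * (2 * n)) + (A - A * n * s x) * (-2 * t * (2 * n)) 
          - A * n * (4 - 4 * t * (s x + t * (1 + ‖x‖ ^ 2)) + 4 * t ^ 2 * ‖x‖ ^ 2) := by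
      rw [Finset.sum_sub_distrib, ← Finset.mul_sum, sum_inner_sq', hg]
      simp only [b.norm_eq_one, Finset.sum_const, Finset.card_univ, nsmul_eq_mul, hcR]
      ring
    have hineq := ineq2 n A t (‖x‖ ^ 2) (s x) hnR hA2 ht ht16 (by
      have : (n:ℝ) ^ 2 * (1 / n) ^ 2 = 1 := by field_simp
      rw [← this]
      gcongr) hx0 hns
    rw [← hsum, ← hdir] at hineq
    rw [Finset.sum_add_distrib, Finset.sum_add_distrib, ← Finset.mul_sum, ← Finset.mul_sum,
      real_inner_self_eq_norm_sq]
    have := mul_neg_of_pos_of_neg (by positivity : 0 < 2 * K) hineq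
    nlinarith
  · refine ⟨?_, ?_⟩
    · rw [mem_closedBall_zero_iff, norm_smul, he, Real.norm_eq_abs, mul_one, abs_of_pos ht,
        le_div_iff₀ (by positivity)]
      nlinarith
    · simp only [hs, Set.mem_ofPred_eq]
      rw [norm_smul, inner_smul_left, real_inner_self_eq_norm_sq, he, Real.norm_eq_abs, mul_one, sq_abs]
      simp
      nlinarith

set_option maxHeartbeats 1000000 in
theorem schwarz_1 [FiniteDimensional ℝ E] (b : OrthonormalBasis ι ℝ E) 
    (hcard : Fintype.card ι = 2) (u : E → ℝ) (hu : ∀ x ∈ ball (0:E) 1, ContDiffAt ℝ 2 u x)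
    (hL : ∀ x ∈ ball (0:E) 1, ∑ i, fderiv ℝ (fderiv ℝ u) x (b i) (b i) = 0)
    (K : ℝ) (hK : 0 < K) (hb : ∀ x, ‖x‖ ≤ 1 / 2 → |u x| ≤ K) (e : E) (he : ‖e‖ = 1)
    (t : ℝ) (ht : 0 < t) (ht' : t ≤ 1 / 4) : u (t • e) - u 0 ≤ 4 * K * t := by
  apply le_of_forall_pos_le_add
  intro ε' hε'
  obtain ⟨ε, hε, hεε⟩ : ∃ ε > 0, 2 * K * ε = ε' := ⟨ε' / (2 * K), by positivity, by field_simp⟩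
  set R : E → E := fun x => t • e + (x + (-2 * inner ℝ x e) • e) with hR
  set s : E → ℝ := fun x => 2 * inner ℝ x e + (-t) with hs
  set p : E → ℝ := fun x => ε + ((4 - ε) * ‖x‖ ^ 2 + ((2 - 2 * t) * s x + (-2) * (s x * s x))) with hp
  have hsc : Continuous s := by simp only [hs]; fun_prop
  have hpc : Continuous p := by simp only [hp]; fun_prop
  set C : Set E := closedBall 0 (1 / 2) ∩ {x | 0 ≤ s x} with hC
  have hCc : IsCompact C := (isCompact_closedBall _ _).inter_right (isClosed_le continuous_const hsc)
  have hRn : ∀ x ∈ C, ‖R x‖ ≤ ‖x‖ := by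
    intro x hx
    have h6 : ‖R x‖ ^ 2 = ‖x‖ ^ 2 - t * s x := by
      simp only [hR, hs]
      rw [← real_inner_self_eq_norm_sq, ← real_inner_self_eq_norm_sq]
      simp only [inner_add_left, inner_add_right, inner_smul_left, inner_smul_right]
      simp only [real_inner_self_eq_norm_sq e, he, real_inner_comm e x]
      simp
      ring
    have h7 : 0 ≤ t * s x := mul_nonneg ht.le hx.2
    exact (sq_le_sq₀ (norm_nonneg _) (norm_nonneg _)).1 (by linarith)
  have hnball : ∀ x ∈ C, x ∈ ball (0:E) 1 ∧ R x ∈ ball (0:E) 1 ∧ ‖x‖ ≤ 1 / 2 := by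
    intro x hx
    have h4 : ‖x‖ ≤ 1 / 2 := mem_closedBall_zero_iff.1 hx.1
    have h5 := hRn x hx
    exact ⟨mem_ball_zero_iff.2 (by linarith), mem_ball_zero_iff.2 (by linarith), h4⟩
  have hsle : ∀ x, ‖x‖ ≤ 1 / 2 → s x ≤ 1 - t := by
    intro x hx
    have h1 : inner ℝ x e ≤ ‖x‖ := by
      have := real_inner_le_norm x e
      rwa [he, mul_one] at this
    simp only [hs]; linarith
  set G : E → ℝ := fun x => u x + ((-1) * u (R x) + (-(2 * K)) * p x) with hG
  have hRc : Continuous R := by simp only [hR]; fun_prop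
  have hGc : ContinuousOn G C := by
    have h1 : ContinuousOn u (ball 0 1) := fun x hx => (hu x hx).continuousAt.continuousWithinAt
    have h2 : ContinuousOn u C := h1.mono fun x hx => (hnball x hx).1
    have h3 : ContinuousOn (fun x => u (R x)) C := h1.comp hRc.continuousOn fun x hx => (hnball x hx).2.1
    simp only [hG]
    exact h2.add ((continuousOn_const.mul h3).add (continuousOn_const.mul hpc.continuousOn))
  have hpos1 : ∀ x : E, ‖x‖ ≤ 1 / 2 → 0 ≤ ε * (1 - ‖x‖ ^ 2) := by
    intro x hx
    apply mul_nonneg hε.le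
    nlinarith [norm_nonneg x]
  have key := max_princ b C hCc G hGc ?_ (t • e) ?_
  · have hte : ‖t • e‖ = t := by rw [norm_smul, he, Real.norm_eq_abs, mul_one, abs_of_pos ht]
    have hin : inner ℝ (t • e) e = t := by
      rw [inner_smul_left, real_inner_self_eq_norm_sq, he]; simp
    have hmw : R (t • e) = 0 := by
      simp only [hR, hin]; module
    have hpw : p (t • e) ≤ 2 * t + ε := by
      simp only [hp, hs]
      rw [hin, hte]
      have : 0 ≤ ε * t ^ 2 := by positivity
      nlinarith
    simp only [hG, hmw] at key
    have : 2 * K * p (t • e) ≤ 2 * K * (2 * t + ε) := mul_le_mul_of_nonneg_left hpw (by positivity)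
    linarith
  · intro x hx
    obtain ⟨hx1, hx2, hx3⟩ := hnball x hx
    have hx0 : 0 ≤ s x := hx.2
    have hns := hsle x hx3
    have hp1 := hpos1 x hx3
    by_cases hsz : s x = 0
    · left
      have h1 : R x = x := by
        have : inner ℝ x e = t / 2 := by simp only [hs] at hsz; linarith
        simp only [hR, this]; module
      simp only [hG, h1, hp, hsz]
      have : 0 ≤ K * ‖x‖ ^ 2 := by positivity
      have : 0 ≤ K * (ε * (1 - ‖x‖ ^ 2)) := by positivity
      linarith
    by_cases hbd : ‖x‖ = 1 / 2
    · left
      have h1 := abs_le.1 (hb x (by linarith))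
      have h2 := abs_le.1 (hb (R x) (by linarith [hRn x hx]))
      have h3 : 1 ≤ p x := by
        simp only [hp]
        rw [hbd] at hp1 ⊢
        have : 0 ≤ s x * (1 - t - s x) := mul_nonneg (by positivity) (by linarith)
        linarith
      have : 2 * K * 1 ≤ 2 * K * p x := mul_le_mul_of_nonneg_left h3 (by positivity)
      simp only [hG]
      linarith
    right
    have hxlt : ‖x‖ < 1 / 2 := lt_of_le_of_ne hx3 hbd
    have hslt : 0 < s x := lt_of_le_of_ne hx0 (Ne.symm hsz)
    refine ⟨Filter.inter_mem (closedBall_mem_nhds_of_mem (mem_ball_zero_iff.2 hxlt))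
      (Filter.mem_of_superset ((isOpen_lt continuous_const hsc).mem_nhds hslt)
        fun y (hy : 0 < s y) => show 0 ≤ s y from le_of_lt hy), ?_⟩
    have hJu := fun v => (J2.line x v).comp (u := u) (by simpa using hu x hx1)
    have hJR : ∀ v, J2 (fun τ : ℝ => R (x + τ • v)) (v + (-2 * inner ℝ e v) • e) 0 := by
      intro v
      have : (fun τ : ℝ => R (x + τ • v)) = fun τ => R x + τ • (v + (-2 * inner ℝ e v) • e) := by
        funext τ
        simp only [hR, inner_add_left, inner_smul_left, real_inner_comm v e]
        simp
        module
      rw [this]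
      exact J2.line _ _
    have hJB := fun v => (hJR v).comp (u := u) (by simpa using hu (R x) hx2)
    have hJs : ∀ v, J2 (fun τ : ℝ => s (x + τ • v)) (2 * inner ℝ v e) 0 := by
      intro v
      refine (((J2.const 2).mul (J2.innerLin x v e)).add (J2.const (-t))).congr' ?_ ?_
      · simp
      · simp
    have hJp : ∀ v, J2 (fun τ : ℝ => p (x + τ • v))
        ((4 - ε) * (2 * inner ℝ x v) + (2 - 2 * t - 4 * s x) * (2 * inner ℝ v e))
        ((4 - ε) * (2 * ‖v‖ ^ 2) - 16 * inner ℝ v e ^ 2) := by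
      intro v
      refine ((J2.const _).add (((J2.const _).mul (J2.normSq x v)).add (((J2.const (2 - 2 * t)).mul (hJs v)).add
        ((J2.const (-2)).mul ((hJs v).mul (hJs v)))))).congr' ?_ ?_
      · simp only [zero_smul, add_zero]; ring
      · simp only [zero_smul, add_zero]; ring
    have hJG := fun v => (hJu v).add (((J2.const (-1)).mul (hJB v)).add
      ((J2.const (-(2 * K))).mul (hJp v)))
    refine ⟨_, _, 0, 1, by norm_num, hJG, ?_⟩
    have hLx := hL x hx1
    have hsymm : ∀ v w, fderiv ℝ (fderiv ℝ u) (R x) v w = fderiv ℝ (fderiv ℝ u) (R x) w v := 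
      fun v w => ((hu _ hx2).isSymmSndFDerivAt (by simp)) v w
    have hLR := trace_refl b _ hsymm e (-2) (by rw [he]; norm_num)
    rw [hL _ hx2] at hLR
    simp only [zero_smul, add_zero, zero_mul, mul_zero, zero_add, map_zero]
    have hcR : (Fintype.card ι : ℝ) = 2 := by rw [hcard]; norm_num
    rw [Finset.sum_add_distrib, Finset.sum_add_distrib, ← Finset.mul_sum, ← Finset.mul_sum, hLx, hLR,
      Finset.sum_sub_distrib, ← Finset.mul_sum, ← Finset.mul_sum, ← Finset.mul_sum, sum_inner_sq', he]
    simp only [b.norm_eq_one, Finset.sum_const, Finset.card_univ, nsmul_eq_mul, hcR]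
    have : 0 < K * ε := by positivity
    nlinarith
  · refine ⟨?_, ?_⟩
    · rw [mem_closedBall_zero_iff, norm_smul, he, Real.norm_eq_abs, mul_one, abs_of_pos ht]
      linarith
    · simp only [hs, Set.mem_ofPred_eq]
      rw [inner_smul_left, real_inner_self_eq_norm_sq, he]
      simp
      linarith

theorem schwarz_all [FiniteDimensional ℝ E] (b : OrthonormalBasis ι ℝ E) (n : ℕ) (hn : 1 ≤ n)
    (hcard : Fintype.card ι = 2 * n) (u : E → ℝ) (hu : ∀ x ∈ ball (0:E) 1, ContDiffAt ℝ 2 u x)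
    (hL : ∀ x ∈ ball (0:E) 1, (1 - ‖x‖ ^ 2) * ∑ i, fderiv ℝ (fderiv ℝ u) x (b i) (b i)
      + 2 * ((Fintype.card ι : ℝ) - 2) * fderiv ℝ u x x = 0)
    (K : ℝ) (hK : 0 < K) (hb : ∀ x, ‖x‖ ≤ 1 / 2 → |u x| ≤ K) (w : E)
    (hw : ‖w‖ * 4 ^ n ≤ 1) : u w - u 0 ≤ 4 ^ n * K * ‖w‖ := by
  rcases eq_or_ne w 0 with rfl | hw0
  · simp
  have hpos : 0 < ‖w‖ := norm_pos_iff.2 hw0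
  have he : ‖‖w‖⁻¹ • w‖ = 1 := by rw [norm_smul, norm_inv, norm_norm, inv_mul_cancel₀ hpos.ne']
  have hw' : ‖w‖ • (‖w‖⁻¹ • w) = w := by rw [smul_smul, mul_inv_cancel₀ hpos.ne', one_smul]
  rcases Nat.lt_or_ge n 2 with h | h
  · obtain rfl : n = 1 := by omega
    have := schwarz_1 b (by simpa using hcard) u hu ?_ K hK hb _ he ‖w‖ hpos (by linarith)
    · rw [hw'] at this; simpa using this
    · intro x hx
      have h1 := hL x hx
      rw [hcard] at h1
      have h2 : 0 < 1 - ‖x‖ ^ 2 := by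
        have := mem_ball_zero_iff.1 hx
        nlinarith [norm_nonneg x]
      norm_num at h1
      rcases h1 with h1 | h1
      · linarith
      · exact h1
  · have := schwarz_ge2 b n h hcard u hu hL K hK hb _ he ‖w‖ hpos hw
    rwa [hw'] at this

def HHar (b : OrthonormalBasis ι ℝ E) (u : E → ℝ) : Prop :=
  ∀ x ∈ ball (0:E) 1, ContDiffAt ℝ 2 u x ∧
    (1 - ‖x‖ ^ 2) * ∑ i, fderiv ℝ (fderiv ℝ u) x (b i) (b i)
      + 2 * ((Fintype.card ι : ℝ) - 2) * fderiv ℝ u x x = 0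

theorem HHar.zero (b : OrthonormalBasis ι ℝ E) : HHar b (fun _ => 0) := by
  intro x hx
  refine ⟨contDiffAt_const, ?_⟩
  have : fderiv ℝ (fun _ : E => (0:ℝ)) = fun _ => 0 := by funext y; simp
  rw [this]; simp

theorem HHar.add {b : OrthonormalBasis ι ℝ E} {u v : E → ℝ} (hu : HHar b u) (hv : HHar b v) :
    HHar b (fun x => u x + v x) := by
  intro x hx
  obtain ⟨u1, u2⟩ := hu x hx
  obtain ⟨v1, v2⟩ := hv x hx
  refine ⟨u1.add v1, ?_⟩
  have h1 : ∀ y ∈ ball (0:E) 1, fderiv ℝ (fun x => u x + v x) y = fderiv ℝ u y + fderiv ℝ v y :=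
    fun y hy => fderiv_fun_add ((hu y hy).1.differentiableAt (by norm_num))
      ((hv y hy).1.differentiableAt (by norm_num))
  have h2 : fderiv ℝ (fun x => u x + v x) =ᶠ[𝓝 x] fun y => fderiv ℝ u y + fderiv ℝ v y := by
    filter_upwards [isOpen_ball.mem_nhds hx] with y hy using h1 y hy
  rw [h2.fderiv_eq, h1 x hx, fderiv_fun_add
    ((u1.fderiv_right (m := 1) (by norm_num)).differentiableAt (by norm_num))
    ((v1.fderiv_right (m := 1) (by norm_num)).differentiableAt (by norm_num))]
  simp only [_root_.add_apply, Finset.sum_add_distrib]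
  linear_combination u2 + v2

theorem HHar.smul {b : OrthonormalBasis ι ℝ E} {u : E → ℝ} (hu : HHar b u) (c : ℝ) :
    HHar b (fun x => c * u x) := by
  intro x hx
  obtain ⟨u1, u2⟩ := hu x hx
  refine ⟨contDiffAt_const.mul u1, ?_⟩
  have h1 : ∀ y ∈ ball (0:E) 1, fderiv ℝ (fun x => c * u x) y = c • fderiv ℝ u y :=
    fun y hy => fderiv_const_mul ((hu y hy).1.differentiableAt (by norm_num)) c
  have h2 : fderiv ℝ (fun x => c * u x) =ᶠ[𝓝 x] fun y => c • fderiv ℝ u y := by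
    filter_upwards [isOpen_ball.mem_nhds hx] with y hy using h1 y hy
  rw [h2.fderiv_eq, h1 x hx, fderiv_fun_const_smul
    ((u1.fderiv_right (m := 1) (by norm_num)).differentiableAt (by norm_num))]
  simp only [_root_.smul_apply, ← Finset.mul_sum, smul_eq_mul]
  linear_combination c * u2

theorem HHar.sum {κ : Type*} {b : OrthonormalBasis ι ℝ E} (S : Finset κ) {u : κ → E → ℝ}
    (hu : ∀ k ∈ S, HHar b (u k)) : HHar b (fun x => ∑ k ∈ S, u k x) := by
  classical
  induction S using Finset.induction_on with
  | empty => simpa using HHar.zero b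
  | insert k S hk ih =>
    simp only [Finset.sum_insert hk]
    exact (hu k (by simp)).add (ih fun j hj => hu j (by simp [hj]))

end

section
open Topology

noncomputable def bC (n : ℕ) : OrthonormalBasis (Σ _ : Fin n, Fin 2) ℝ (Cn n) :=
  Pi.orthonormalBasis fun _ => Complex.orthonormalBasisOneI

theorem bC_zero (n : ℕ) (k : Fin n) : bC n ⟨k, 0⟩ = EuclideanSpace.single k 1 := by
  simp [bC, Pi.orthonormalBasis_apply]

theorem bC_one (n : ℕ) (k : Fin n) : bC n ⟨k, 1⟩ = EuclideanSpace.single k Complex.I := by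
  simp [bC, Pi.orthonormalBasis_apply]

theorem decomp (n : ℕ) (z : Cn n) : z = ∑ k, ((z k).re • EuclideanSpace.single k (1:ℂ) +
    (z k).im • EuclideanSpace.single k Complex.I) := by
  ext j
  simp [Finset.sum_apply, Finset.sum_add_distrib, Pi.single_apply]

theorem hh_of_laplace (n : ℕ) (u : Cn n → ℝ) (hu : ContDiffOn ℝ 2 u (ball 0 1))
    (hL : ∀ z ∈ ball (0 : Cn n) 1, laplaceH n u z = 0) : HHar (bC n) u := by
  intro z hz
  have h1 : ContDiffAt ℝ 2 u z := hu.contDiffAt (isOpen_ball.mem_nhds hz)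
  refine ⟨h1, ?_⟩
  have h2 := hL z hz
  have h3 : DifferentiableAt ℝ (fderiv ℝ u) z :=
    (h1.fderiv_right (m := 1) (by norm_num)).differentiableAt (by norm_num)
  have h4 : ∀ e, fderiv ℝ (fun w => fderiv ℝ u w e) z e = fderiv ℝ (fderiv ℝ u) z e e := by
    intro e
    rw [(h3.hasFDerivAt.clm_apply (hasFDerivAt_const e z)).fderiv]
    simp
  have h5 : ∑ k, ((z k).re * fderiv ℝ u z (EuclideanSpace.single k 1) +
            (z k).im * fderiv ℝ u z (EuclideanSpace.single k Complex.I)) = fderiv ℝ u z z := by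
    conv_rhs => rw [decomp n z]
    simp only [map_sum, map_add, map_smul, smul_eq_mul]
    rw [← decomp n z]
  have h6 : 0 < 1 - ‖z‖ ^ 2 := by
    have := mem_ball_zero_iff.1 hz
    nlinarith [norm_nonneg z]
  rw [laplaceH, h5] at h2
  simp only [h4] at h2
  rw [Fintype.sum_sigma]
  simp only [Fin.sum_univ_two, bC_zero, bC_one]
  simp only [Fintype.card_sigma, Fintype.card_fin, Finset.sum_const, Finset.card_univ, smul_eq_mul]
  push_cast
  apply mul_left_cancel₀ h6.ne'
  rw [mul_zero, ← h2]
  ring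

theorem euclNorm_eq (n : ℕ) (v : Fin n → ℂ) : euclNorm n v = ‖WithLp.toLp 2 v‖ := by
  rw [euclNorm, EuclideanSpace.norm_eq]
  simp [Complex.normSq_eq_norm_sq]

theorem le_matOpNorm (n : ℕ) (A : Matrix (Fin n) (Fin n) ℂ) (θ : Cn n) (hθ : θ ∈ sphere (0 : Cn n) 1) :
    euclNorm n (A.mulVec fun k => θ k) ≤ matOpNorm n A := by
  unfold matOpNorm
  apply le_csSup
  · apply IsCompact.bddAbove
    apply (isCompact_sphere _ _).image
    simp only [euclNorm, Matrix.mulVec, dotProduct]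
    have := Complex.continuous_normSq
    fun_prop
  · exact ⟨θ, hθ, rfl⟩

theorem mat_bound (n : ℕ) (hn : 1 ≤ n) (A : Cn n → Matrix (Fin n) (Fin n) ℂ)
    (hA : ∀ j k, IsHHarmonic n (fun w => A w j k)) (K M : ℝ) (hK : 0 < K) (hM : 0 < M)
    (hAK : ∀ z, ‖z‖ ≤ 1 / 2 → matOpNorm n (A z) ≤ K) (hA0 : matOpNorm n (A 0) ≤ M)
    (w : Cn n) (hw : ‖w‖ ≤ 1 / 2) :
    matOpNorm n (A w - A 0) ≤ 4 ^ n * (K + M) * ‖w‖ := by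
  unfold matOpNorm
  have hne : (sphere (0 : Cn n) 1).Nonempty := by
    refine ⟨EuclideanSpace.single ⟨0, hn⟩ 1, ?_⟩
    simp
  apply csSup_le (hne.image _)
  rintro _ ⟨θ, hθ, rfl⟩
  simp only
  set c : Cn n := WithLp.toLp 2 ((A w - A 0).mulVec fun k => θ k) with hc
  rw [euclNorm_eq, ← hc]
  rcases eq_or_ne c 0 with h0 | h0
  · rw [h0, norm_zero]; positivity
  have hcpos : 0 < ‖c‖ := norm_pos_iff.2 h0
  set φ : Cn n := ((‖c‖⁻¹ : ℝ) : ℂ) • c with hφ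
  have hφn : ‖φ‖ = 1 := by
    rw [hφ, norm_smul, Complex.norm_real, norm_inv, norm_norm, inv_mul_cancel₀ hcpos.ne']
  set u : Cn n → ℝ := fun z => (inner ℂ φ (WithLp.toLp 2 ((A z).mulVec fun k => θ k) : Cn n)).re with hu
  have hub : ∀ z, |u z| ≤ matOpNorm n (A z) := by
    intro z
    refine (Complex.abs_re_le_norm _).trans ?_
    refine (norm_inner_le_norm _ _).trans ?_
    rw [hφn, one_mul, ← euclNorm_eq]
    exact le_matOpNorm n _ θ hθ
  have hdiff : u w - u 0 = ‖c‖ := by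
    simp only [hu]
    rw [← Complex.sub_re, ← inner_sub_right, ← WithLp.toLp_sub, ← Matrix.sub_mulVec, ← hc, hφ,
      inner_smul_left, inner_self_eq_norm_sq_to_K, Complex.conj_ofReal]
    have : ((‖c‖⁻¹ : ℝ) : ℂ) * ((‖c‖ : ℂ)) ^ 2 = ((‖c‖ : ℝ) : ℂ) := by
      have : (‖c‖ : ℂ) ≠ 0 := by exact_mod_cast hcpos.ne'
      push_cast
      field_simp
    exact congrArg Complex.re this
  rw [← hdiff]
  have huH : HHar (bC n) u := by
    have : u = fun z => ∑ j, ∑ k, ((starRingEnd ℂ (φ j) * θ k).re * (A z j k).re +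
        (-(starRingEnd ℂ (φ j) * θ k).im) * (A z j k).im) := by
      funext z
      simp only [hu, PiLp.inner_apply, Matrix.mulVec, dotProduct, Complex.re_sum]
      refine Finset.sum_congr rfl fun j _ => ?_
      have : inner ℂ (φ j) (∑ k, A z j k * θ k) = ∑ k, (starRingEnd ℂ (φ j) * θ k) * A z j k := by
        rw [RCLike.inner_apply, Finset.sum_mul]
        refine Finset.sum_congr rfl fun k _ => ?_
        ring
      rw [this, Complex.re_sum]
      refine Finset.sum_congr rfl fun k _ => ?_
      rw [Complex.mul_re]; ring
    rw [this]
    refine HHar.sum _ fun j _ => HHar.sum _ fun k _ => HHar.add (HHar.smul ?_ _) (HHar.smul ?_ _)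
    · exact hh_of_laplace n _ (Complex.reCLM.contDiff.comp_contDiffOn (hA j k).1)
        fun z hz => ((hA j k).2 z hz).1
    · exact hh_of_laplace n _ (Complex.imCLM.contDiff.comp_contDiffOn (hA j k).1)
        fun z hz => ((hA j k).2 z hz).2
  have hKM : 4 ^ n * K * ‖w‖ ≤ 4 ^ n * (K + M) * ‖w‖ := by gcongr; linarith
  rcases le_or_gt (‖w‖ * 4 ^ n) 1 with h | h
  · refine le_trans ?_ hKM
    exact schwarz_all (bC n) n hn (by simp [mul_comm]) u (fun x hx => (huH x hx).1)
      (fun x hx => (huH x hx).2) K hK (fun x hx => (hub x).trans (hAK x hx)) w h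
  · have h1 := abs_le.1 ((hub w).trans (hAK w hw))
    have h2 := abs_le.1 ((hub 0).trans hA0)
    nlinarith

theorem fderiv_F (n : ℕ) (f : Cn n → Cn n) (j : Fin n) (ζ : Cn n)
    (hd : DifferentiableAt ℝ (fun w => f w j) ((2:ℂ)⁻¹ • ζ)) :
    fderiv ℝ (fun w => ((2 : ℂ) • f ((2 : ℂ)⁻¹ • w)) j) ζ = fderiv ℝ (fun w => f w j) ((2:ℂ)⁻¹ • ζ) := by
  have h2 : ∀ w : Cn n, (2:ℂ)⁻¹ • w = (2:ℝ)⁻¹ • w := by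
    intro w; ext i; simp
  have h1 : (fun w => ((2 : ℂ) • f ((2 : ℂ)⁻¹ • w)) j) = fun w => (2:ℝ) • (fun w => f w j) ((2:ℝ)⁻¹ • w) := by
    funext w
    rw [h2]; simp
  rw [h2] at hd ⊢
  rw [h1, fderiv_fun_const_smul, fderiv_comp_smul (f := fun w => f w j), smul_smul]
  · norm_num
  · exact DifferentiableAt.comp (g := fun w => f w j) ζ hd (by fun_prop)

theorem matOpNorm_nonneg (n : ℕ) (A : Matrix (Fin n) (Fin n) ℂ) : 0 ≤ matOpNorm n A := by
  apply Real.sSup_nonneg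
  rintro _ ⟨θ, -, rfl⟩
  exact Real.sqrt_nonneg _

end

/-- Under the Landau–Bloch hypotheses (`f(0) = 0`, `det J_f(0) = 1`,
`‖f‖_{HB_n(α)} ≤ M`), set `F(ζ) = 2 f(ζ/2)`. Then for all `ζ ∈ Bⁿ`,
`|F_ζ(ζ) − F_ζ(0)| ≤ (2^{2n−1}(3^α + 4^α)M/3^α)|ζ|` and likewise for `F_{ζ̄}`
(operator norms). -/
theorem rescaled_derivative_growth (n : ℕ) (hn : 1 ≤ n) (α M : ℝ) (hα : 0 < α) (hM : 0 < M)
    (f : Cn n → Cn n) (hf : IsPHH n f) (hf0 : f 0 = 0)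
    (hjac : (realJac n f 0).det = 1)
    (hbd : ∀ z ∈ ball (0 : Cn n) 1,
      (1 - ‖z‖ ^ 2) ^ α * (matOpNorm n (fzMat n f z) + matOpNorm n (fzbarMat n f z)) ≤ M)
    (F : Cn n → Cn n) (hF : F = fun ζ => (2 : ℂ) • f ((2 : ℂ)⁻¹ • ζ))
    (ζ : Cn n) (hζ : ζ ∈ ball (0 : Cn n) 1) :
    matOpNorm n (fzMat n F ζ - fzMat n F 0) ≤
        2 ^ (2 * n - 1) * ((3 : ℝ) ^ α + (4 : ℝ) ^ α) * M / (3 : ℝ) ^ α * ‖ζ‖ ∧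
      matOpNorm n (fzbarMat n F ζ - fzbarMat n F 0) ≤
        2 ^ (2 * n - 1) * ((3 : ℝ) ^ α + (4 : ℝ) ^ α) * M / (3 : ℝ) ^ α * ‖ζ‖ := by
  have hfd : ∀ j, ∀ z ∈ ball (0 : Cn n) 1, DifferentiableAt ℝ (fun w => f w j) z := by
    intro j z hz
    have h1 := (hf.1.contDiffAt (isOpen_ball.mem_nhds hz)).differentiableAt (by norm_num)
    exact (differentiableAt_piLp 2).1 h1 j
  have hζn : ‖ζ‖ < 1 := mem_ball_zero_iff.1 hζ
  have hhalf : ∀ z : Cn n, ‖(2:ℂ)⁻¹ • z‖ = ‖z‖ / 2 := by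
    intro z; rw [norm_smul]; simp; ring
  have hz1 : ∀ z ∈ ball (0 : Cn n) 1, fzMat n F z = fzMat n f ((2:ℂ)⁻¹ • z) ∧
      fzbarMat n F z = fzbarMat n f ((2:ℂ)⁻¹ • z) := by
    intro z hz
    have hz' : (2:ℂ)⁻¹ • z ∈ ball (0 : Cn n) 1 := by
      rw [mem_ball_zero_iff] at hz ⊢
      rw [hhalf]; linarith [norm_nonneg z]
    subst hF
    constructor
    · funext j k
      simp only [fzMat, wdz]
      rw [fderiv_F n f j z (hfd j _ hz')]
    · funext j k
      simp only [fzbarMat, wdzbar]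
      rw [fderiv_F n f j z (hfd j _ hz')]
  have h0 : (0 : Cn n) ∈ ball (0 : Cn n) 1 := by simp
  rw [(hz1 ζ hζ).1, (hz1 ζ hζ).2, (hz1 0 h0).1, (hz1 0 h0).2, smul_zero]
  have h3 : (0:ℝ) < 3 ^ α := by positivity
  have h4 : (0:ℝ) < 4 ^ α := by positivity
  have hsum : ∀ z : Cn n, ‖z‖ ≤ 1 / 2 →
      matOpNorm n (fzMat n f z) + matOpNorm n (fzbarMat n f z) ≤ 4 ^ α / 3 ^ α * M := by
    intro z hz
    have hb := hbd z (mem_ball_zero_iff.2 (by linarith))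
    have h5 : (3 / 4 : ℝ) ^ α ≤ (1 - ‖z‖ ^ 2) ^ α := by
      apply Real.rpow_le_rpow (by norm_num) _ hα.le
      nlinarith [norm_nonneg z]
    have h6 : 0 ≤ matOpNorm n (fzMat n f z) + matOpNorm n (fzbarMat n f z) :=
      add_nonneg (matOpNorm_nonneg _ _) (matOpNorm_nonneg _ _)
    have h7 := (mul_le_mul_of_nonneg_right h5 h6).trans hb
    rw [Real.div_rpow (by norm_num) (by norm_num)] at h7
    rw [div_mul_eq_mul_div, le_div_iff₀ h3]
    rw [div_mul_eq_mul_div, div_le_iff₀ h4] at h7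
    linarith
  have hsum0 : matOpNorm n (fzMat n f 0) + matOpNorm n (fzbarMat n f 0) ≤ M := by
    have hb := hbd 0 h0
    simpa using hb
  have hpow : (4:ℝ) ^ n = 2 * 2 ^ (2 * n - 1) := by
    rw [← pow_succ', show 2 * n - 1 + 1 = 2 * n by omega, pow_mul]; norm_num
  have hfin : 2 ^ (2 * n - 1) * ((3 : ℝ) ^ α + (4 : ℝ) ^ α) * M / (3 : ℝ) ^ α * ‖ζ‖ =
      4 ^ n * (4 ^ α / 3 ^ α * M + M) * ‖(2:ℂ)⁻¹ • ζ‖ := by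
    rw [hhalf, hpow]
    field_simp
    ring
  rw [hfin]
  have hw : ‖(2:ℂ)⁻¹ • ζ‖ ≤ 1 / 2 := by rw [hhalf]; linarith
  constructor
  · apply mat_bound n hn (fzMat n f) (fun j k => (hf.2 j k).1) _ _ (by positivity) hM _ _ _ hw
    · intro z hz
      linarith [hsum z hz, matOpNorm_nonneg n (fzbarMat n f z)]
    · linarith [matOpNorm_nonneg n (fzbarMat n f 0)]
  · apply mat_bound n hn (fzbarMat n f) (fun j k => (hf.2 j k).2) _ _ (by positivity) hM _ _ _ hw
    · intro z hz
      linarith [hsum z hz, matOpNorm_nonneg n (fzMat n f z)]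
    · linarith [matOpNorm_nonneg n (fzMat n f 0)]
end
end
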